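/- arXiv:2605.12634 — 14 statements merged into one kernel-verified Lean document; each statement's English description precedes it below -/
import Mathlib

section
/- For every positive integer z, the clique number of the Sperner graph S(z) equals the chromatic number of S(z), and both are equal to the central binomial coefficient choose(z, ⌊z/2⌋). -/
open Finset

/-- A `d`-cover-free family `d`-CFF(t,n): for all pairwise distinct indices
`i₀, i₁, …, i_d`, the block `B i₀` is not contained in the union of the `d` others. -/
def IsCFF (d t n : ℕ) (B : Fin n → Finset (Fin t)) : Prop :=
  ∀ (i₀ : Fin n) (S : Finset (Fin n)), S.card = d → i₀ ∉ S →
    ¬ B i₀ ⊆ S.biUnion B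

/-- `t(d,n)`: the least `t` for which a `d`-CFF(t,n) exists. -/
noncomputable def tCFF (d n : ℕ) : ℕ :=
  sInf {t | ∃ B : Fin n → Finset (Fin t), IsCFF d t n B}

/-- The set system `B` is Sperner for the pair `a, b`. -/
def SpernerFor {V : Type*} {t : ℕ} (B : V → Finset (Fin t)) (a b : V) : Prop :=
  (B a \ B b).Nonempty ∧ (B b \ B a).Nonempty

/-- `B` is a `G`-Sperner set system. -/
def IsGSperner {V : Type*} (G : SimpleGraph V) {t : ℕ} (B : V → Finset (Fin t)) : Prop :=
  ∀ a b, G.Adj a b → SpernerFor B a b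

/-- The set system `B` is cover-free for the pair `a, b`. -/
def CoverFreeFor {V : Type*} {t : ℕ} (B : V → Finset (Fin t)) (a b : V) : Prop :=
  ∀ c, c ≠ a → c ≠ b → (B c \ (B a ∪ B b)).Nonempty

/-- `B` is a `G`-ECFF: cover-free for every edge of `G`. -/
def IsGECFF {V : Type*} (G : SimpleGraph V) {t : ℕ} (B : V → Finset (Fin t)) : Prop :=
  ∀ a b, G.Adj a b → CoverFreeFor B a b

/-- `B` is a `G`-CFF: a `G`-ECFF that is also `G`-Sperner. -/
def IsGCFF {V : Type*} (G : SimpleGraph V) {t : ℕ} (B : V → Finset (Fin t)) : Prop :=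
  IsGECFF G B ∧ IsGSperner G B

/-- `t_s(G)`: least `t` admitting a `G`-Sperner set system. -/
noncomputable def tS {V : Type*} (G : SimpleGraph V) : ℕ :=
  sInf {t | ∃ B : V → Finset (Fin t), IsGSperner G B}

/-- `t_e(G)`: least `t` admitting a `G`-ECFF set system. -/
noncomputable def tE {V : Type*} (G : SimpleGraph V) : ℕ :=
  sInf {t | ∃ B : V → Finset (Fin t), IsGECFF G B}

/-- `t(G)`: least `t` admitting a `G`-CFF set system. -/
noncomputable def tG {V : Type*} (G : SimpleGraph V) : ℕ :=
  sInf {t | ∃ B : V → Finset (Fin t), IsGCFF G B}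

/-- The Sperner graph of order `z`: vertices are all subsets of a `z`-set,
with `x ~ y` iff `x` and `y` are incomparable under inclusion. -/
def spernerGraph (z : ℕ) : SimpleGraph (Finset (Fin z)) where
  Adj x y := (x \ y).Nonempty ∧ (y \ x).Nonempty
  symm := ⟨fun _ _ h => ⟨h.2, h.1⟩⟩
  loopless := ⟨fun x h => by simp at h⟩

lemma layer_hall (z r : ℕ) (hr : 2 * r + 1 ≤ z) :
    ∃ f : Finset (Fin z) → Finset (Fin z),
      (∀ s, #s = r → s ⊆ f s ∧ #(f s) = r + 1) ∧
      (∀ s t, #s = r → #t = r → f s = f t → s = t) := by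
  classical
  let N : {s : Finset (Fin z) // #s = r} → Finset (Finset (Fin z)) :=
    fun s => univ.filter (fun t => s.1 ⊆ t ∧ #t = r + 1)
  have key : ∀ A : Finset {s : Finset (Fin z) // #s = r}, #A ≤ #(A.biUnion N) := by
    intro A
    have h := Finset.card_mul_le_card_mul (s := A) (t := A.biUnion N)
      (fun (a : {s : Finset (Fin z) // #s = r}) b => a.1 ⊆ b) (m := z - r) (n := r + 1) ?_ ?_
    · have h1 : #A * (r + 1) ≤ #A * (z - r) := Nat.mul_le_mul_left _ (by omega)
      exact Nat.le_of_mul_le_mul_right (h1.trans h) (by omega)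
    · intro a ha
      have hc : #(a.1ᶜ.image (fun x => insert x a.1)) = z - r := by
        rw [Finset.card_image_of_injOn, Finset.card_compl, a.2, Fintype.card_fin]
        intro x hx y hy hxy
        have hx' : x ∉ a.1 := by simpa using hx
        have : x ∈ insert y a.1 := by
          have h2 : insert x a.1 = insert y a.1 := hxy
          rw [← h2]; exact mem_insert_self _ _
        rcases mem_insert.1 this with h | h
        · exact h
        · exact absurd h hx'
      rw [← hc]
      apply Finset.card_le_card
      intro t ht
      obtain ⟨x, hx, rfl⟩ := mem_image.1 ht
      have hx' : x ∉ a.1 := by simpa using hx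
      rw [Finset.mem_bipartiteAbove]
      refine ⟨mem_biUnion.2 ⟨a, ha, ?_⟩, subset_insert _ _⟩
      simp only [N, mem_filter, mem_univ, true_and]
      exact ⟨subset_insert _ _, by rw [card_insert_of_notMem hx', a.2]⟩
    · intro b hb
      obtain ⟨a, ha, hab⟩ := mem_biUnion.1 hb
      simp only [N, mem_filter, mem_univ, true_and] at hab
      have : (A.bipartiteBelow (fun a b => a.1 ⊆ b) b).image Subtype.val ⊆ b.powersetCard r := by
        intro t ht
        obtain ⟨c, hc, rfl⟩ := mem_image.1 ht
        rw [Finset.mem_bipartiteBelow] at hc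
        exact mem_powersetCard.2 ⟨hc.2, c.2⟩
      have h3 := Finset.card_le_card this
      rw [Finset.card_image_of_injective _ Subtype.val_injective, card_powersetCard, hab.2] at h3
      simpa using h3
  obtain ⟨g, hg, hgN⟩ := (Finset.all_card_le_biUnion_card_iff_exists_injective N).1 key
  refine ⟨fun s => if h : #s = r then g ⟨s, h⟩ else s, ?_, ?_⟩
  · intro s hs
    have := hgN ⟨s, hs⟩
    simp only [N, mem_filter, mem_univ, true_and] at this
    simpa [hs] using this
  · intro s t hs ht h
    simp only [hs, ht, dite_true] at h
    simpa using hg h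

lemma lower_chains (z m : ℕ) (hm : 2 * m ≤ z + 1) (k : ℕ) (hk : k ≤ m) :
    ∃ F : Finset (Fin z) → Finset (Fin z),
      (∀ s, m - k ≤ #s → #s ≤ m → s ⊆ F s ∧ #(F s) = m) ∧
      (∀ s t, m - k ≤ #s → #s ≤ m → m - k ≤ #t → #t ≤ m → F s = F t → s ⊆ t ∨ t ⊆ s) := by
  classical
  induction k with
  | zero =>
    refine ⟨id, fun s h1 h2 => ⟨subset_rfl, ?_⟩, fun s t _ _ _ _ h => Or.inl (le_of_eq h)⟩
    simp only [id]; omega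
  | succ k ih =>
    obtain ⟨F, hF, hFF⟩ := ih (by omega)
    obtain ⟨f, hf, hff⟩ := layer_hall z (m - (k + 1)) (by omega)
    have aux : ∀ s t, #s = m - (k+1) → m - k ≤ #t → #t ≤ m → F (f s) = F t → s ⊆ t := by
      intro s t hs ht1 ht2 h
      obtain ⟨h1, h2⟩ := hf s hs
      rcases hFF (f s) t (by omega) (by omega) ht1 ht2 h with h3 | h3
      · exact h1.trans h3
      · have := Finset.eq_of_subset_of_card_le h3 (by omega)
        rw [this]; exact h1
    refine ⟨fun s => if #s = m - (k + 1) then F (f s) else F s, ?_, ?_⟩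
    · intro s h1 h2
      by_cases hs : #s = m - (k + 1)
      · simp only [hs, if_true]
        obtain ⟨h3, h4⟩ := hf s hs
        obtain ⟨h5, h6⟩ := hF (f s) (by omega) (by omega)
        exact ⟨h3.trans h5, h6⟩
      · simp only [hs, if_false]
        exact hF s (by omega) h2
    · intro s t hs1 hs2 ht1 ht2 h
      by_cases hs : #s = m - (k + 1) <;> by_cases ht : #t = m - (k + 1) <;>
        simp only [hs, ht, if_true, if_false] at h
      · left
        obtain ⟨h3, h4⟩ := hf s hs
        obtain ⟨h5, h6⟩ := hf t ht
        apply le_of_eq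
        apply hff s t hs ht
        rcases hFF (f s) (f t) (by omega) (by omega) (by omega) (by omega) h with h7 | h7
        · exact Finset.eq_of_subset_of_card_le h7 (by omega)
        · exact (Finset.eq_of_subset_of_card_le h7 (by omega)).symm
      · exact Or.inl (aux s t hs (by omega) ht2 h)
      · exact Or.inr (aux t s ht (by omega) hs2 h.symm)
      · exact hFF s t (by omega) hs2 (by omega) ht2 h

lemma spernerGraph_colorable (z : ℕ) : (spernerGraph z).Colorable (z.choose (z / 2)) := by
  classical
  obtain ⟨F, hF, hFF⟩ := lower_chains z (z / 2) (by omega) (z / 2) le_rfl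
  obtain ⟨G, hG, hGG⟩ := lower_chains z (z - z / 2) (by omega) (z - z / 2) le_rfl
  simp only [Nat.sub_self, Nat.zero_le, true_imp_iff] at hF hFF hG hGG
  have hcc : ∀ s : Finset (Fin z), #sᶜ = z - #s := fun s => by
    rw [Finset.card_compl, Fintype.card_fin]
  have hle : ∀ s : Finset (Fin z), #s ≤ z := fun s => by
    simpa using Finset.card_le_univ s
  let c : Finset (Fin z) → Finset (Fin z) := fun s => if #s ≤ z / 2 then F s else (G sᶜ)ᶜ
  have hc : ∀ s, #(c s) = z / 2 := by
    intro s
    by_cases hs : #s ≤ z / 2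
    · simp only [c, hs, if_true]; exact (hF s hs).2
    · simp only [c, hs, if_false]
      rw [hcc, (hG sᶜ (by rw [hcc]; omega)).2]; omega
  have aux : ∀ s t, #s ≤ z / 2 → ¬ #t ≤ z / 2 → F s = (G tᶜ)ᶜ → s ⊆ t := by
    intro s t hs ht h
    have h1 := (hF s hs).1
    have h2 := (hG tᶜ (by rw [hcc]; omega)).1
    rw [h] at h1
    refine h1.trans ?_
    have := Finset.compl_subset_compl.2 h2
    simpa using this
  have hchain : ∀ s t, c s = c t → s ⊆ t ∨ t ⊆ s := by
    intro s t h
    by_cases hs : #s ≤ z / 2 <;> by_cases ht : #t ≤ z / 2 <;>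
      simp only [c, hs, ht, if_true, if_false] at h
    · exact hFF s t hs ht h
    · exact Or.inl (aux s t hs ht h)
    · exact Or.inr (aux t s ht hs h.symm)
    · have := hGG sᶜ tᶜ (by rw [hcc]; omega) (by rw [hcc]; omega) (compl_injective h)
      simpa only [Finset.compl_subset_compl, or_comm] using this
  let C : (spernerGraph z).Coloring {s : Finset (Fin z) // #s = z / 2} :=
    SimpleGraph.Coloring.mk (fun s => ⟨c s, hc s⟩) (by
      intro s t hst h
      have h' : c s = c t := congrArg Subtype.val h
      obtain ⟨h1, h2⟩ := hst
      rcases hchain s t h' with h3 | h3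
      · rw [Finset.sdiff_eq_empty_iff_subset.2 h3] at h1; simp at h1
      · rw [Finset.sdiff_eq_empty_iff_subset.2 h3] at h2; simp at h2)
  have := C.colorable
  simpa using this

lemma spernerGraph_clique (z : ℕ) :
    (spernerGraph z).IsNClique (z.choose (z / 2)) (Finset.powersetCard (z / 2) univ) := by
  refine ⟨?_, by simp⟩
  intro s hs t ht hne
  have hs' : #s = z / 2 := by simpa using hs
  have ht' : #t = z / 2 := by simpa using ht
  refine ⟨?_, ?_⟩ <;> rw [Finset.sdiff_nonempty] <;> intro h
  · exact hne (Finset.eq_of_subset_of_card_le h (by omega))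
  · exact hne (Finset.eq_of_subset_of_card_le h (by omega)).symm

theorem stmt_0 (z : ℕ) (hz : 0 < z) :
    (spernerGraph z).cliqueNum = z.choose (z / 2) ∧
    (spernerGraph z).chromaticNumber = (z.choose (z / 2) : ℕ∞) := by
  have hcol := spernerGraph_colorable z
  have hcl := spernerGraph_clique z
  constructor
  · apply le_antisymm
    · obtain ⟨s, hs⟩ := (spernerGraph z).exists_isNClique_cliqueNum
      rw [← hs.card_eq]
      exact hs.isClique.card_le_of_colorable hcol
    · have := SimpleGraph.IsClique.card_le_cliqueNum (tc := hcl.isClique)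
      rwa [hcl.card_eq] at this
  · apply le_antisymm
    · exact hcol.chromaticNumber_le
    · have := hcl.isClique.card_le_chromaticNumber
      rwa [hcl.card_eq] at this
end

section
/- Let G be a finite simple graph with at least one vertex and no isolated vertices (every vertex lies in some edge). Then t_s(G) = t(1, χ(G)), where χ(G) is the chromatic number of G. -/
open Finset

theorem aux_up (t m : ℕ) (h : 2 * m + 1 ≤ t) :
    ∃ φ : Finset (Fin t) → Finset (Fin t),
      (∀ s, s.card = m → (φ s).card = m + 1 ∧ s ⊆ φ s) ∧
      (∀ s u, s.card = m → u.card = m → φ s = φ u → s = u) := by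
  classical
  let T : {s : Finset (Fin t) // s.card = m} → Finset (Finset (Fin t)) :=
    fun s => (s.1ᶜ).image (fun x => insert x s.1)
  have hT : ∀ s, ∀ u ∈ T s, u.card = m + 1 ∧ s.1 ⊆ u := by
    intro s u hu
    simp only [T, Finset.mem_image, Finset.mem_compl] at hu
    obtain ⟨x, hx, rfl⟩ := hu
    exact ⟨by rw [Finset.card_insert_of_notMem hx, s.2], Finset.subset_insert _ _⟩
  have hTc : ∀ s, (T s).card = t - m := by
    intro s
    simp only [T]
    rw [Finset.card_image_of_injOn, Finset.card_compl, Fintype.card_fin, s.2]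
    intro x hx y hy hxy
    simp only [Finset.coe_compl, Set.mem_compl_iff, Finset.mem_coe] at hx hy
    have : x ∈ insert y s.1 := by
      have h2 : insert x s.1 = insert y s.1 := hxy
      rw [← h2]; exact Finset.mem_insert_self _ _
    rcases Finset.mem_insert.1 this with h | h
    · exact h
    · exact absurd h hx
  have hall : ∀ A : Finset {s : Finset (Fin t) // s.card = m}, A.card ≤ (A.biUnion T).card := by
    intro A
    have key := Finset.card_mul_le_card_mul (s := A) (t := A.biUnion T)
      (fun s u => u ∈ T s) (m := m + 1) (n := m + 1) ?_ ?_
    · exact Nat.le_of_mul_le_mul_right key (Nat.succ_pos m)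
    · intro s hs
      have : T s ⊆ Finset.bipartiteAbove (fun s u => u ∈ T s) (A.biUnion T) s := by
        intro u hu
        rw [Finset.mem_bipartiteAbove]
        exact ⟨Finset.mem_biUnion.2 ⟨s, hs, hu⟩, hu⟩
      have := Finset.card_le_card this
      rw [hTc] at this
      omega
    · intro u hu
      obtain ⟨s0, _, hs0⟩ := Finset.mem_biUnion.1 hu
      have hu1 := (hT s0 u hs0).1
      calc _ = ((Finset.bipartiteBelow (fun s u => u ∈ T s) A u).map
              (Function.Embedding.subtype _)).card := (Finset.card_map _).symm
        _ ≤ (Finset.powersetCard m u).card := by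
            apply Finset.card_le_card
            intro s hs
            simp only [Finset.mem_map, Finset.mem_bipartiteBelow] at hs
            obtain ⟨s, ⟨_, hs⟩, rfl⟩ := hs
            rw [Finset.mem_powersetCard]
            exact ⟨(hT s u hs).2, s.2⟩
        _ = m + 1 := by rw [Finset.card_powersetCard, hu1, Nat.choose_succ_self_right]
  obtain ⟨f, hf, hfT⟩ := (Finset.all_card_le_biUnion_card_iff_exists_injective T).1 hall
  refine ⟨fun s => if hs : s.card = m then f ⟨s, hs⟩ else s, ?_, ?_⟩
  · intro s hs
    simp only [hs, dif_pos]
    exact hT ⟨s, hs⟩ _ (hfT ⟨s, hs⟩)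
  · intro s u hs hu he
    simp only [hs, hu, dif_pos] at he
    exact congrArg Subtype.val (hf he)

theorem aux_low (t m : ℕ) (h : 2 * m ≤ t + 1) :
    ∃ g : Finset (Fin t) → Finset (Fin t),
      (∀ s, s.card ≤ m → (g s).card = m ∧ s ⊆ g s) ∧
      (∀ s u, s.card ≤ m → u.card ≤ m → g s = g u → s ⊆ u ∨ u ⊆ s) := by
  classical
  induction m with
  | zero =>
    refine ⟨id, fun s hs => ⟨by simpa using hs, subset_rfl⟩, fun s u _ _ he => Or.inl ?_⟩
    exact (show s = u from he) ▸ subset_rfl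
  | succ m ih =>
    obtain ⟨g, h1, h2⟩ := ih (by omega)
    obtain ⟨φ, p1, p2⟩ := aux_up t m (by omega)
    have hA : ∀ s : Finset (Fin t), s.card ≤ m →
        (φ (g s)).card = m + 1 ∧ s ⊆ φ (g s) := fun s hs =>
      ⟨(p1 _ (h1 s hs).1).1, (h1 s hs).2.trans (p1 _ (h1 s hs).1).2⟩
    refine ⟨fun s => if s.card ≤ m then φ (g s) else s, ?_, ?_⟩
    · intro s hs
      by_cases hm : s.card ≤ m
      · simp only [hm, if_true]; exact hA s hm
      · simp only [hm, if_false]; exact ⟨by omega, subset_rfl⟩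
    · intro s u hs hu he
      by_cases hm : s.card ≤ m <;> by_cases hn : u.card ≤ m <;>
        simp only [hm, hn, if_true, if_false] at he
      · exact h2 s u hm hn (p2 _ _ (h1 s hm).1 (h1 u hn).1 he)
      · exact Or.inl (he ▸ (hA s hm).2)
      · exact Or.inr (he ▸ (hA u hn).2)
      · exact Or.inl (he ▸ subset_rfl)

theorem aux_chain (t : ℕ) :
    ∃ f : Finset (Fin t) → Finset (Fin t),
      (∀ s, (f s).card = t / 2) ∧ (∀ s u, f s = f u → s ⊆ u ∨ u ⊆ s) := by
  classical
  obtain ⟨g, g1, g2⟩ := aux_low t (t / 2) (by omega)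
  obtain ⟨k, k1, k2⟩ := aux_low t (t - t / 2) (by omega)
  have hc : ∀ s : Finset (Fin t), sᶜ.card = t - s.card := fun s => by
    rw [Finset.card_compl, Fintype.card_fin]
  have hk : ∀ s : Finset (Fin t), ¬ s.card ≤ t / 2 → sᶜ.card ≤ t - t / 2 := fun s hs => by
    rw [hc]; omega
  have hk' : ∀ s : Finset (Fin t), ¬ s.card ≤ t / 2 → (k sᶜ)ᶜ ⊆ s := fun s hs => by
    have := Finset.compl_subset_compl.2 (k1 _ (hk s hs)).2
    rwa [compl_compl] at this
  refine ⟨fun s => if s.card ≤ t / 2 then g s else (k sᶜ)ᶜ, ?_, ?_⟩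
  · intro s
    by_cases hm : s.card ≤ t / 2
    · simp only [hm, if_true]; exact (g1 s hm).1
    · simp only [hm, if_false]
      rw [hc, (k1 _ (hk s hm)).1]; omega
  · intro s u he
    by_cases hm : s.card ≤ t / 2 <;> by_cases hn : u.card ≤ t / 2 <;>
      simp only [hm, hn, if_true, if_false] at he
    · exact g2 s u hm hn he
    · exact Or.inl ((g1 s hm).2.trans (he ▸ hk' u hn))
    · exact Or.inr ((g1 u hn).2.trans (he ▸ hk' s hm))
    · have := k2 _ _ (hk s hm) (hk u hn) (compl_injective he)
      rw [Finset.compl_subset_compl, Finset.compl_subset_compl] at this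
      exact this.symm

theorem stmt_3 {V : Type*} [Fintype V] [Nonempty V] (G : SimpleGraph V)
    (hiso : ∀ v : V, ∃ u, G.Adj v u) :
    tS G = tCFF 1 G.chromaticNumber.toNat := by
  classical
  have hfin : G.Colorable (G.chromaticNumber.toNat) := by
    have h1 : G.Colorable (Fintype.card V) := G.colorable_of_fintype
    exact SimpleGraph.colorable_chromaticNumber h1
  unfold tS tCFF
  congr 1
  ext t
  constructor
  · rintro ⟨B, hB⟩
    obtain ⟨f, f1, f2⟩ := aux_chain t
    let P := {s : Finset (Fin t) // s ∈ Finset.powersetCard (t / 2) Finset.univ}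
    let C : G.Coloring P := SimpleGraph.Coloring.mk
      (fun v => ⟨f (B v), by rw [Finset.mem_powersetCard]; exact ⟨Finset.subset_univ _, f1 _⟩⟩)
      (by
        intro a b hab he
        obtain ⟨h1, h2⟩ := hB a b hab
        rw [Finset.sdiff_nonempty] at h1 h2
        rcases f2 _ _ (congrArg Subtype.val he) with h | h
        · exact h1 h
        · exact h2 h)
    have hcol := C.colorable
    have hle : G.chromaticNumber.toNat ≤ Fintype.card P :=
      ENat.toNat_le_of_le_coe hcol.chromaticNumber_le
    obtain ⟨e⟩ : Nonempty (Fin G.chromaticNumber.toNat ↪ P) :=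
      Function.Embedding.nonempty_of_card_le (by simpa using hle)
    refine ⟨fun i => (e i).1, ?_⟩
    intro i S hS hi hsub
    obtain ⟨j, rfl⟩ := Finset.card_eq_one.1 hS
    rw [Finset.singleton_biUnion] at hsub
    have ci := (Finset.mem_powersetCard.1 (e i).2).2
    have cj := (Finset.mem_powersetCard.1 (e j).2).2
    have := Finset.eq_of_subset_of_card_le hsub (by rw [ci, cj])
    exact hi (Finset.mem_singleton.2 (e.injective (Subtype.ext this)))
  · rintro ⟨B, hB⟩
    obtain ⟨C⟩ := hfin
    refine ⟨fun v => B (C v), ?_⟩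
    have key : ∀ a b, G.Adj a b → (B (C a) \ B (C b)).Nonempty := by
      intro a b hab
      rw [Finset.sdiff_nonempty]
      intro h
      refine hB (C a) {C b} (Finset.card_singleton _) ?_ ?_
      · rw [Finset.mem_singleton]; exact C.valid hab
      · rwa [Finset.singleton_biUnion]
    exact fun a b hab => ⟨key a b hab, key b a hab.symm⟩
end

section
/- Let G be a finite simple graph with no isolated vertices, on n vertices. Then every G-CFF set system B : V(G) → Finset (Fin t) is a 1-CFF(t, n); that is, for all distinct vertices u and v of G, B u is not a subset of B v. -/
open Finset

theorem stmt_4 {V : Type*} [Fintype V] (G : SimpleGraph V)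
    (hiso : ∀ v : V, ∃ u, G.Adj v u) {t : ℕ} (B : V → Finset (Fin t))
    (hB : IsGCFF G B) :
    ∀ u v : V, u ≠ v → ¬ B u ⊆ B v := by
  intro u v huv hsub
  obtain ⟨w, hw⟩ := hiso v
  by_cases h : u = w
  · subst h
    obtain ⟨x, hx⟩ := (hB.2 v u hw).2
    rw [Finset.mem_sdiff] at hx
    exact hx.2 (hsub hx.1)
  · obtain ⟨x, hx⟩ := hB.1 v w hw u huv h
    rw [Finset.mem_sdiff, Finset.mem_union] at hx
    exact hx.2 (Or.inl (hsub hx.1))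
end

section
/- Let G be a finite simple graph on n ≥ 3 vertices with no isolated vertices. Then t(1, n) ≤ t(G) ≤ t(2, n). -/
open Finset

theorem stmt_5 {V : Type*} [Fintype V] (G : SimpleGraph V)
    (hn : 3 ≤ Fintype.card V) (hiso : ∀ v : V, ∃ u, G.Adj v u) :
    tCFF 1 (Fintype.card V) ≤ tG G ∧ tG G ≤ tCFF 2 (Fintype.card V) := by
  classical
  let e := Fintype.equivFin V
  constructor
  · have hne : {t | ∃ B : V → Finset (Fin t), IsGCFF G B}.Nonempty := by
      refine ⟨Fintype.card V, fun v => {e v}, ?_, ?_⟩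
      · intro a b _ c hca hcb
        refine ⟨e c, ?_⟩
        simp [hca, hcb]
      · intro a b h
        exact ⟨⟨e a, by simp [h.ne]⟩, ⟨e b, by simp [h.ne']⟩⟩
    obtain ⟨B, hE, hS⟩ := Nat.sInf_mem hne
    refine Nat.sInf_le ⟨fun i => B (e.symm i), ?_⟩
    intro i S hS1 hi hsub
    obtain ⟨j, rfl⟩ := Finset.card_eq_one.mp hS1
    have hij : e.symm i ≠ e.symm j := by
      intro h
      exact hi (by simpa using h)
    replace hsub : B (e.symm i) ⊆ B (e.symm j) := by
      intro x hx
      obtain ⟨k, hk, hxk⟩ := Finset.mem_biUnion.mp (hsub hx)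
      rw [Finset.mem_singleton] at hk
      subst hk
      exact hxk
    obtain ⟨u, hu⟩ := hiso (e.symm j)
    by_cases hui : e.symm i = u
    · subst hui
      obtain ⟨x, hx⟩ := (hS _ _ hu).2
      rw [Finset.mem_sdiff] at hx
      exact hx.2 (hsub hx.1)
    · obtain ⟨x, hx⟩ := hE _ _ hu _ hij hui
      rw [Finset.mem_sdiff, Finset.mem_union] at hx
      exact hx.2 (Or.inl (hsub hx.1))
  · have hne : {t | ∃ B : Fin (Fintype.card V) → Finset (Fin t),
        IsCFF 2 t (Fintype.card V) B}.Nonempty := by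
      refine ⟨Fintype.card V, fun v => {v}, ?_⟩
      intro i S _ hi hsub
      apply hi
      simpa using hsub
    obtain ⟨B, hB⟩ := Nat.sInf_mem hne
    have key : ∀ a b c : V, a ≠ b → c ≠ a → c ≠ b →
        (B (e c) \ (B (e a) ∪ B (e b))).Nonempty := by
      intro a b c hab hca hcb
      have h := hB (e c) {e a, e b} (Finset.card_pair (by simpa using hab))
        (by simp [hca, hcb])
      rw [Finset.sdiff_nonempty]
      simpa [Finset.biUnion_insert] using h
    have half : ∀ a b : V, a ≠ b → (B (e a) \ B (e b)).Nonempty := by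
      intro a b hab
      obtain ⟨c, hca, hcb⟩ : ∃ c, c ≠ a ∧ c ≠ b := by
        by_contra! hc
        have h1 : (Finset.univ : Finset V) ⊆ {a, b} := by
          intro c _
          by_cases h : c = a
          · simp [h]
          · simp [hc c h]
        have h2 := Finset.card_le_card h1
        have h3 := Finset.card_le_two (a := a) (b := b)
        rw [Finset.card_univ] at h2
        omega
      obtain ⟨x, hx⟩ := key b c a hcb.symm hab hca.symm
      rw [Finset.mem_sdiff, Finset.mem_union] at hx
      exact ⟨x, Finset.mem_sdiff.mpr ⟨hx.1, fun h => hx.2 (Or.inl h)⟩⟩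
    refine Nat.sInf_le ⟨fun v => B (e v), ?_, ?_⟩
    · intro a b h c hca hcb
      exact key a b c h.ne hca hcb
    · intro a b h
      exact ⟨half a b h.ne, half b a h.ne'⟩
end

section
/- Let G be a finite simple graph with no isolated vertices. Then the following are equivalent: (i) for every natural number t, every G-ECFF set system B : V(G) → Finset (Fin t) is also G-Sperner (hence a G-CFF); (ii) every vertex of G has degree at least 2. -/
open Finset

theorem stmt_7 {V : Type*} [Fintype V] [DecidableEq V] (G : SimpleGraph V)
    [DecidableRel G.Adj] (hiso : ∀ v : V, ∃ u, G.Adj v u) :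
    (∀ (t : ℕ) (B : V → Finset (Fin t)), IsGECFF G B → IsGSperner G B) ↔
      ∀ v : V, 2 ≤ G.degree v := by
  constructor
  · intro h v
    by_contra hv
    obtain ⟨u, hu⟩ := hiso v
    have huniq : ∀ w, G.Adj v w → w = u := by
      intro w hw
      have h1 : (G.neighborFinset v).card ≤ 1 := by
        rw [SimpleGraph.card_neighborFinset_eq_degree]; omega
      exact Finset.card_le_one.mp h1 w (by simpa using hw) u (by simpa using hu)
    let e := Fintype.equivFin V
    let B : V → Finset (Fin (Fintype.card V)) := fun x =>
      if x = v then {e u, e v} else {e x}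
    have hmem : ∀ x y, e y ∈ B x ↔ (y = x ∨ (x = v ∧ y = u)) := by
      intro x y
      by_cases hx : x = v
      · simp [B, hx, or_comm]
      · simp [B, hx]
    have hne : u ≠ v := hu.ne'
    have hE : IsGECFF G B := by
      intro a b hab c hca hcb
      refine ⟨e c, ?_⟩
      rw [Finset.mem_sdiff, Finset.mem_union, hmem, hmem, hmem]
      refine ⟨Or.inl rfl, ?_⟩
      rintro ((h1 | ⟨h1, h2⟩) | (h1 | ⟨h1, h2⟩))
      · exact hca h1
      · subst h1
        exact hcb (h2.trans (huniq b hab).symm)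
      · exact hcb h1
      · subst h1
        exact hca (h2.trans (huniq a hab.symm).symm)
    obtain ⟨-, x, hx⟩ := h _ B hE v u hu
    obtain ⟨y, rfl⟩ := e.surjective x
    rw [Finset.mem_sdiff, hmem, hmem] at hx
    tauto
  · intro h t B hB
    have key : ∀ a b, G.Adj a b → (B a \ B b).Nonempty := by
      intro a b hab
      have h1 : 1 < (G.neighborFinset b).card := by
        rw [SimpleGraph.card_neighborFinset_eq_degree]; exact h b
      obtain ⟨c, hc, hca⟩ := Finset.exists_mem_ne h1 a
      have hbc : G.Adj b c := by simpa using hc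
      obtain ⟨x, hx⟩ := hB b c hbc a hab.ne hca.symm
      refine ⟨x, ?_⟩
      simp only [Finset.mem_sdiff, Finset.mem_union] at hx ⊢
      tauto
    exact fun a b hab => ⟨key a b hab, key b a hab.symm⟩
end

section
/- If G is a finite simple graph in which every vertex has degree at least 2, then t(G) = t_e(G). -/
open Finset

theorem ecff_aux {V : Type*} [Fintype V] [DecidableEq V] (G : SimpleGraph V)
    [DecidableRel G.Adj] (hdeg : ∀ v : V, 2 ≤ G.degree v) {t : ℕ}
    (B : V → Finset (Fin t)) (h : IsGECFF G B) (a b : V) (hab : G.Adj a b) :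
    (B a \ B b).Nonempty := by
  have h1 : 1 < (G.neighborFinset b).card := by
    rw [G.card_neighborFinset_eq_degree]; exact hdeg b
  obtain ⟨c, hc, hca⟩ := Finset.exists_mem_ne h1 a
  rw [SimpleGraph.mem_neighborFinset] at hc
  obtain ⟨x, hx⟩ := h b c hc a hab.ne hca.symm
  refine ⟨x, ?_⟩
  simp only [Finset.mem_sdiff, Finset.mem_union, not_or] at hx ⊢
  exact ⟨hx.1, hx.2.1⟩

theorem stmt_8 {V : Type*} [Fintype V] [DecidableEq V] (G : SimpleGraph V)
    [DecidableRel G.Adj] (hdeg : ∀ v : V, 2 ≤ G.degree v) :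
    tG G = tE G := by
  unfold tG tE
  congr 1
  ext t
  constructor
  · rintro ⟨B, hB⟩
    exact ⟨B, hB.1⟩
  · rintro ⟨B, hB⟩
    exact ⟨B, hB, fun a b hab =>
      ⟨ecff_aux G hdeg B hB a b hab, ecff_aux G hdeg B hB b a hab.symm⟩⟩
end

section
/- Let G be a finite simple graph with no isolated vertices. Then t(G) ≤ t_e(G) + 2. Moreover, if no connected component of G consists of a single edge (equivalently, G has no edge both of whose endpoints have degree 1), then t(G) ≤ t_e(G) + 1. -/
open Finset

theorem aux_leaf {V : Type*} [Fintype V] [DecidableEq V] (G : SimpleGraph V)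
    [DecidableRel G.Adj] {a b c : V} (h : G.degree a = 1) (hb : G.Adj a b) (hc : G.Adj a c) :
    b = c := by
  rw [← SimpleGraph.card_neighborFinset_eq_degree] at h
  exact Finset.card_le_one.1 h.le b (by simpa using hb) c (by simpa using hc)

theorem aux_ext {V : Type*} [Fintype V] [DecidableEq V] (G : SimpleGraph V)
    [DecidableRel G.Adj] (k : ℕ) (S : V → Finset (Fin k))
    (hS : ∀ a b, G.Adj a b → G.degree a = 1 → (S b \ S a).Nonempty) :
    tG G ≤ tE G + k := by
  have hne : {t | ∃ B : V → Finset (Fin t), IsGECFF G B}.Nonempty := by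
    refine ⟨Fintype.card V, fun v => {Fintype.equivFin V v}, ?_⟩
    intro a b _ c hca hcb
    exact ⟨Fintype.equivFin V c, by simp [hca, hcb]⟩
  obtain ⟨B, hB⟩ := Nat.sInf_mem hne
  change V → Finset (Fin (tE G)) at B
  change IsGECFF G B at hB
  let B' : V → Finset (Fin (tE G + k)) := fun v =>
    (B v).image (Fin.castAdd k) ∪ (S v).image (Fin.natAdd (tE G))
  have m1 : ∀ v x, Fin.castAdd k x ∈ B' v ↔ x ∈ B v := by
    intro v x
    simp only [B', Finset.mem_union, Finset.mem_image]
    constructor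
    · rintro (⟨y, hy, h⟩ | ⟨y, hy, h⟩)
      · rwa [← Fin.castAdd_injective _ _ h]
      · have := congrArg Fin.val h
        simp at this
        omega
    · exact fun h => Or.inl ⟨x, h, rfl⟩
  have m2 : ∀ v x, Fin.natAdd (tE G) x ∈ B' v ↔ x ∈ S v := by
    intro v x
    simp only [B', Finset.mem_union, Finset.mem_image]
    constructor
    · rintro (⟨y, hy, h⟩ | ⟨y, hy, h⟩)
      · have := congrArg Fin.val h
        simp at this
        omega
      · rwa [← Fin.natAdd_injective _ _ h]
    · exact fun h => Or.inr ⟨x, h, rfl⟩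
  have key : ∀ a b, G.Adj a b → (B' b \ B' a).Nonempty := by
    intro a b hab
    by_cases h : G.degree a = 1
    · obtain ⟨x, hx⟩ := hS a b hab h
      rw [Finset.mem_sdiff] at hx
      exact ⟨Fin.natAdd _ x, by rw [Finset.mem_sdiff, m2, m2]; exact hx⟩
    · have : ∃ c, G.Adj a c ∧ b ≠ c := by
        by_contra hcon
        push Not at hcon
        apply h
        rw [← SimpleGraph.card_neighborFinset_eq_degree, Finset.card_eq_one]
        refine ⟨b, ?_⟩
        ext c
        simp only [SimpleGraph.mem_neighborFinset, Finset.mem_singleton]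
        exact ⟨fun hc => (hcon c hc).symm, fun hc => hc ▸ hab⟩
      obtain ⟨c, hac, hbc⟩ := this
      obtain ⟨x, hx⟩ := hB a c hac b hab.ne' hbc
      rw [Finset.mem_sdiff, Finset.mem_union] at hx
      exact ⟨Fin.castAdd _ x, by rw [Finset.mem_sdiff, m1, m1]; tauto⟩
  refine Nat.sInf_le ⟨B', ?_, fun a b hab => ⟨key b a hab.symm, key a b hab⟩⟩
  intro a b hab c hca hcb
  obtain ⟨x, hx⟩ := hB a b hab c hca hcb
  rw [Finset.mem_sdiff, Finset.mem_union] at hx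
  exact ⟨Fin.castAdd _ x, by rw [Finset.mem_sdiff, m1, Finset.mem_union, m1, m1]; exact hx⟩

theorem stmt_9 {V : Type*} [Fintype V] [DecidableEq V] (G : SimpleGraph V)
    [DecidableRel G.Adj] (hiso : ∀ v : V, ∃ u, G.Adj v u) :
    tG G ≤ tE G + 2 ∧
      ((∀ a b : V, G.Adj a b → ¬(G.degree a = 1 ∧ G.degree b = 1)) →
        tG G ≤ tE G + 1) := by
  classical
  constructor
  · let e := Fintype.equivFin V
    let P : V → Prop := fun v =>
      G.degree v = 1 ∧ ∃ u, G.Adj v u ∧ (G.degree u ≠ 1 ∨ e u < e v)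
    apply aux_ext G 2 (fun v => if P v then {1} else {0})
    intro a b hab ha
    have hne : e a ≠ e b := fun h => hab.ne (e.injective h)
    have hP : P a ↔ ¬ P b := by
      have h1 : P a ↔ (G.degree b ≠ 1 ∨ e b < e a) := by
        constructor
        · rintro ⟨_, u, hu, h⟩
          rwa [aux_leaf G ha hab hu]
        · exact fun h => ⟨ha, b, hab, h⟩
      by_cases hb : G.degree b = 1
      · have h2 : P b ↔ e a < e b := by
          constructor
          · rintro ⟨_, u, hu, h⟩
            obtain rfl := aux_leaf G hb hab.symm hu
            exact h.resolve_left (fun h => h ha)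
          · exact fun h => ⟨hb, a, hab.symm, Or.inr h⟩
        rw [h1, h2]
        simp only [hb, ne_eq, not_true_eq_false, false_or, not_lt]
        exact ⟨le_of_lt, fun h => lt_of_le_of_ne h hne.symm⟩
      · have : ¬ P b := fun h => hb h.1
        rw [h1]
        tauto
    by_cases h : P b
    · have h' : ¬ P a := fun h' => hP.1 h' h
      simp only [h, h', if_true, if_false]
      decide
    · have h' : P a := hP.2 h
      simp only [h, h', if_true, if_false]
      decide
  · intro hcomp
    apply aux_ext G 1 (fun v => if G.degree v = 1 then ∅ else {0})
    intro a b hab ha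
    have hb : G.degree b ≠ 1 := fun hb => hcomp a b hab ⟨ha, hb⟩
    simp [ha, hb]
end

section
/- Let G be a finite simple graph and let c : V(G) → Fin k be a proper vertex coloring of G with every color class nonempty. For each color i, let n_i be the number of vertices of color i, and set t_i = t(1, n_i) if n_i ≥ 2 and t_i = 1 if n_i = 1. Then t(G) ≤ t_1 + t_2 + ⋯ + t_k; in particular, there exists a G-CFF set system on a ground set of size t_1 + ⋯ + t_k. -/
open Finset

theorem tCFF_one_spec (n : ℕ) : ∃ B : Fin n → Finset (Fin (tCFF 1 n)), IsCFF 1 (tCFF 1 n) n B := by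
  have h : {t | ∃ B : Fin n → Finset (Fin t), IsCFF 1 t n B}.Nonempty := by
    refine ⟨n, fun i => {i}, ?_⟩
    intro i S _ hi hsub
    apply hi
    simpa using hsub
  exact Nat.sInf_mem h

theorem class_blocks {V : Type*} [DecidableEq V] (s : Finset V) :
    ∃ f : V → Finset (Fin (if 2 ≤ s.card then tCFF 1 s.card else 1)),
      (∀ v ∈ s, (f v).Nonempty) ∧ ∀ v ∈ s, ∀ w ∈ s, v ≠ w → ¬ f v ⊆ f w := by
  by_cases h : 2 ≤ s.card
  · rw [if_pos h]
    obtain ⟨B, hB⟩ := tCFF_one_spec s.card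
    have key : ∀ i j, i ≠ j → ¬ B i ⊆ B j := by
      intro i j hij hs
      exact hB i {j} (by simp) (by simpa using hij) (by simpa using hs)
    have h2 : ∀ v ∈ s, ∀ w ∈ s, v ≠ w →
        ¬ (if h : v ∈ s then B (s.equivFin ⟨v, h⟩) else ∅) ⊆
          (if h : w ∈ s then B (s.equivFin ⟨w, h⟩) else ∅) := by
      intro v hv w hw hvw
      rw [dif_pos hv, dif_pos hw]
      apply key
      simpa using hvw
    refine ⟨fun v => if h : v ∈ s then B (s.equivFin ⟨v, h⟩) else ∅, ?_, h2⟩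
    intro v hv
    obtain ⟨w, hw, hwv⟩ := Finset.exists_mem_ne (by omega : 1 < s.card) v
    rw [Finset.nonempty_iff_ne_empty]
    intro he
    apply h2 v hv w hw hwv.symm
    have he' : (if h : v ∈ s then B (s.equivFin ⟨v, h⟩) else ∅) = ∅ := he
    rw [he']
    exact Finset.empty_subset _
  · rw [if_neg h]
    refine ⟨fun _ => {0}, by simp, ?_⟩
    intro v hv w hw hvw
    exact absurd (Finset.one_lt_card.2 ⟨v, hv, w, hw, hvw⟩) (by omega)

theorem exists_GCFF_of_coloring {V : Type*} (G : SimpleGraph V)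
    (k : ℕ) (c : V → Fin k) (hc : ∀ a b : V, G.Adj a b → c a ≠ c b)
    (t : Fin k → ℕ) (f : ∀ i, V → Finset (Fin (t i)))
    (h1 : ∀ v, (f (c v) v).Nonempty)
    (h2 : ∀ v w, c v = c w → v ≠ w → ¬ f (c v) v ⊆ f (c v) w) :
    ∃ B : V → Finset (Fin (∑ i, t i)), IsGCFF G B := by
  let g : V → Finset (Fin (∑ i, t i)) := fun v =>
    ((f (c v) v).map (Function.Embedding.sigmaMk (β := fun i => Fin (t i)) (c v))).map
      finSigmaFinEquiv.toEmbedding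
  have hg : ∀ v w x, finSigmaFinEquiv (⟨c v, x⟩ : Σ i, Fin (t i)) ∈ g w ↔
      c v = c w ∧ x ∈ f (c v) w := by
    intro v w x
    simp only [g, Finset.mem_map, Equiv.coe_toEmbedding, EmbeddingLike.apply_eq_iff_eq,
      Function.Embedding.sigmaMk_apply, exists_eq_right]
    generalize c v = i at *
    generalize hj : c w = j
    constructor
    · rintro ⟨y, hy, he⟩
      cases he
      exact ⟨rfl, hy⟩
    · rintro ⟨rfl, hx⟩
      exact ⟨x, hx, rfl⟩
  refine ⟨g, ?_, ?_⟩
  · intro a b hab v hva hvb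
    have main : ∃ x ∈ f (c v) v, ¬ (c v = c a ∧ x ∈ f (c v) a) ∧
        ¬ (c v = c b ∧ x ∈ f (c v) b) := by
      have := hc a b hab
      by_cases ha : c v = c a
      · obtain ⟨x, hx, hx'⟩ := Finset.not_subset.1 (h2 v a ha hva)
        exact ⟨x, hx, fun h => hx' h.2, fun h => this (ha.symm.trans h.1)⟩
      · by_cases hb : c v = c b
        · obtain ⟨x, hx, hx'⟩ := Finset.not_subset.1 (h2 v b hb hvb)
          exact ⟨x, hx, fun h => ha h.1, fun h => hx' h.2⟩
        · obtain ⟨x, hx⟩ := h1 v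
          exact ⟨x, hx, fun h => ha h.1, fun h => hb h.1⟩
    obtain ⟨x, hx, hxa, hxb⟩ := main
    refine ⟨finSigmaFinEquiv ⟨c v, x⟩, ?_⟩
    rw [Finset.mem_sdiff, Finset.mem_union, hg, hg, hg]
    exact ⟨⟨rfl, hx⟩, fun h => h.elim hxa hxb⟩
  · have half : ∀ a b, c a ≠ c b → (g a \ g b).Nonempty := by
      intro a b hab
      obtain ⟨x, hx⟩ := h1 a
      refine ⟨finSigmaFinEquiv ⟨c a, x⟩, ?_⟩
      rw [Finset.mem_sdiff, hg, hg]
      exact ⟨⟨rfl, hx⟩, fun h => hab h.1⟩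
    intro a b hab
    exact ⟨half a b (hc a b hab), half b a (hc a b hab).symm⟩

theorem stmt_10 {V : Type*} [Fintype V] [DecidableEq V] (G : SimpleGraph V)
    (k : ℕ) (c : V → Fin k)
    (hc : ∀ a b : V, G.Adj a b → c a ≠ c b)
    (hne : ∀ i : Fin k, ∃ v : V, c v = i) :
    tG G ≤ (∑ i : Fin k,
        if 2 ≤ (Finset.univ.filter (fun v => c v = i)).card
        then tCFF 1 (Finset.univ.filter (fun v => c v = i)).card
        else 1) ∧
      ∃ B : V → Finset (Fin (∑ i : Fin k,
        if 2 ≤ (Finset.univ.filter (fun v => c v = i)).card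
        then tCFF 1 (Finset.univ.filter (fun v => c v = i)).card
        else 1)), IsGCFF G B := by
  have key : ∃ B : V → Finset (Fin (∑ i : Fin k,
        if 2 ≤ (Finset.univ.filter (fun v => c v = i)).card
        then tCFF 1 (Finset.univ.filter (fun v => c v = i)).card
        else 1)), IsGCFF G B := by
    choose f h1 h2 using fun i : Fin k =>
      class_blocks (Finset.univ.filter (fun v => c v = i))
    apply exists_GCFF_of_coloring G k c hc _ f
    · intro v
      exact h1 (c v) v (by simp)
    · intro v w hvw hne
      exact h2 (c v) v (by simp) w (by simp [hvw]) hne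
  exact ⟨Nat.sInf_le key, key⟩
end

section
/- Let n ≥ 3 and let G be a finite simple graph on n vertices with no isolated vertices. Then max{ t(1, n) + 1, t(G) } ≤ t(G + {x}) ≤ t(G) + 1, where G + {x} is the graph obtained from G by adding one new universal vertex. -/
open Finset

/-- `G + {x}`: the graph `G` together with a new universal vertex (`none`). -/
def addUniversal {V : Type*} (G : SimpleGraph V) : SimpleGraph (Option V) where
  Adj a b :=
    match a, b with
    | some u, some v => G.Adj u v
    | some _, none => True
    | none, some _ => True
    | none, none => False
  symm := by
    constructor
    rintro (_ | u) (_ | v) h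
    · exact h.elim
    · trivial
    · trivial
    · exact G.adj_symm h
  loopless := by
    constructor
    rintro (_ | u) h
    · exact h
    · exact G.loopless.irrefl u h

theorem aux_tG_exists {V : Type*} [Fintype V] (G : SimpleGraph V) :
    ∃ B : V → Finset (Fin (Fintype.card V)), IsGCFF G B := by
  let e := Fintype.equivFin V
  refine ⟨fun v => {e v}, ?_, ?_⟩
  · intro a b _ c hca hcb
    refine ⟨e c, ?_⟩
    simp [hca, hcb]
  · intro a b hab
    refine ⟨⟨e a, ?_⟩, ⟨e b, ?_⟩⟩
    · simp [hab.ne]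
    · simp [hab.ne']

theorem aux_upper {V : Type*} (G : SimpleGraph V) (hiso : ∀ v : V, ∃ u, G.Adj v u)
    {t : ℕ} (B : V → Finset (Fin t)) (hB : IsGCFF G B) :
    ∃ B' : Option V → Finset (Fin (t + 1)), IsGCFF (addUniversal G) B' := by
  have hsep : ∀ v w, w ≠ v → ∃ x, x ∈ B w ∧ x ∉ B v := by
    intro v w hwv
    obtain ⟨u, hu⟩ := hiso v
    by_cases h : w = u
    · subst h
      obtain ⟨x, hx⟩ := (hB.2 v w hu).2
      exact ⟨x, by simpa using hx⟩
    · obtain ⟨x, hx⟩ := hB.1 v u hu w hwv h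
      simp at hx
      exact ⟨x, hx.1, hx.2.1⟩
  have hne : ∀ v, ∃ x, x ∈ B v := by
    intro v
    obtain ⟨u, hu⟩ := hiso v
    obtain ⟨x, hx, -⟩ := hsep u v hu.ne
    exact ⟨x, hx⟩
  let B' : Option V → Finset (Fin (t + 1)) := fun o =>
    match o with
    | none => {Fin.last t}
    | some v => (B v).map Fin.castSuccEmb
  have h0 : ∀ x, x ∈ B' none ↔ x = Fin.last t := fun x => by simp [B']
  have h1 : ∀ v x, Fin.castSucc x ∈ B' (some v) ↔ x ∈ B v := fun v x => by simp [B']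
  have h2 : ∀ v, Fin.last t ∉ B' (some v) := fun v h => by
    simp [B', Fin.castSucc_ne_last] at h
  have h3 : ∀ x : Fin t, Fin.castSucc x ∉ B' none := fun x => by
    simp [h0, Fin.castSucc_ne_last]
  refine ⟨B', ?_, ?_⟩
  · rintro (_ | a) (_ | b) hab (_ | c) hca hcb
    · exact absurd rfl hca
    · exact hab.elim
    · exact absurd rfl hca
    · obtain ⟨x, hx, hx'⟩ := hsep b c (by simpa using hcb)
      exact ⟨x.castSucc, by simp [h1, h3, hx, hx']⟩
    · exact absurd rfl hcb
    · obtain ⟨x, hx, hx'⟩ := hsep a c (by simpa using hca)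
      exact ⟨x.castSucc, by simp [h1, h3, hx, hx']⟩
    · exact ⟨Fin.last t, by simp [h0, h2]⟩
    · obtain ⟨x, hx⟩ := hB.1 a b hab c (by simpa using hca) (by simpa using hcb)
      exact ⟨x.castSucc, by simpa [h1] using hx⟩
  · rintro (_ | a) (_ | b) hab
    · exact hab.elim
    · obtain ⟨x, hx⟩ := hne b
      exact ⟨⟨Fin.last t, by simp [h0, h2]⟩, ⟨x.castSucc, by simp [h1, h3, hx]⟩⟩
    · obtain ⟨x, hx⟩ := hne a
      exact ⟨⟨x.castSucc, by simp [h1, h3, hx]⟩, ⟨Fin.last t, by simp [h0, h2]⟩⟩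
    · obtain ⟨⟨x, hx⟩, ⟨y, hy⟩⟩ := hB.2 a b hab
      exact ⟨⟨x.castSucc, by simpa [h1] using hx⟩, ⟨y.castSucc, by simpa [h1] using hy⟩⟩

theorem aux_restrict {V : Type*} (G : SimpleGraph V) {t : ℕ}
    (B : Option V → Finset (Fin t)) (hB : IsGCFF (addUniversal G) B) :
    IsGCFF G (fun v => B (some v)) :=
  ⟨fun a b hab c hca hcb => hB.1 (some a) (some b) hab (some c) (by simpa using hca)
    (by simpa using hcb), fun a b hab => hB.2 (some a) (some b) hab⟩

theorem aux_lower {V : Type*} [Fintype V] [Nonempty V] (G : SimpleGraph V) {t : ℕ}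
    (B : Option V → Finset (Fin t)) (hB : IsGCFF (addUniversal G) B) :
    tCFF 1 (Fintype.card V) + 1 ≤ t := by
  obtain ⟨v₀⟩ := (inferInstance : Nonempty V)
  obtain ⟨p, hp⟩ := (hB.2 none (some v₀) trivial).1
  rw [Finset.mem_sdiff] at hp
  obtain _ | s := t
  · exact p.elim0
  let e := (Fintype.equivFin V).symm
  refine Nat.succ_le_succ (Nat.sInf_le
    ⟨fun i => univ.filter fun j => p.succAbove j ∈ B (some (e i)) \ B none, ?_⟩)
  intro i S hS hi hsub
  obtain ⟨k, rfl⟩ := Finset.card_eq_one.1 hS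
  have hik : i ≠ k := by simpa using hi
  obtain ⟨x, hx⟩ := hB.1 none (some (e k)) trivial (some (e i)) (by simp) (by simpa using hik)
  simp at hx
  have hxp : x ≠ p := fun h => hx.2.1 (h ▸ hp.1)
  obtain ⟨j, rfl⟩ := Fin.exists_succAbove_eq hxp
  have := @hsub j (by simp [hx])
  simp [hx] at this

theorem stmt_12 {V : Type*} [Fintype V] (G : SimpleGraph V)
    (hn : 3 ≤ Fintype.card V) (hiso : ∀ v : V, ∃ u, G.Adj v u) :
    max (tCFF 1 (Fintype.card V) + 1) (tG G) ≤ tG (addUniversal G) ∧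
      tG (addUniversal G) ≤ tG G + 1 := by
  have : Nonempty V := Fintype.card_pos_iff.1 (by omega)
  obtain ⟨B, hB⟩ := Nat.sInf_mem (s := {t | ∃ B : V → Finset (Fin t), IsGCFF G B})
    ⟨_, aux_tG_exists G⟩
  have hU := aux_upper G hiso B hB
  obtain ⟨B', hB'⟩ := Nat.sInf_mem
    (s := {t | ∃ B : Option V → Finset (Fin t), IsGCFF (addUniversal G) B}) ⟨_, hU⟩
  exact ⟨max_le (aux_lower G B' hB') (Nat.sInf_le ⟨_, aux_restrict G B' hB'⟩), Nat.sInf_le hU⟩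
end

section
/- For every n ≥ 3, the star graph S_n satisfies t_e(S_n) = t(1, n−1). -/
open Finset

/-- The star graph `S_n` on `Fin n`: edges are exactly the pairs `{0, i}` for `i ≠ 0`. -/
def starGraph (n : ℕ) : SimpleGraph (Fin n) where
  Adj a b := a ≠ b ∧ (a.val = 0 ∨ b.val = 0)
  symm := ⟨fun _ _ h => ⟨h.1.symm, h.2.symm⟩⟩
  loopless := ⟨fun _ h => h.1 rfl⟩

theorem stmt_14 (n : ℕ) (hn : 3 ≤ n) :
    tE (starGraph n) = tCFF 1 (n - 1) := by
  obtain ⟨m, rfl⟩ : ∃ m, n = m + 1 := ⟨n - 1, by omega⟩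
  unfold tE tCFF
  congr 1
  ext t
  simp only [Set.mem_setOf_eq, Nat.add_sub_cancel]
  constructor
  · rintro ⟨B, hB⟩
    refine ⟨fun i => B i.succ, ?_⟩
    intro i S hS hi hsub
    obtain ⟨j, rfl⟩ := Finset.card_eq_one.mp hS
    have hij : i ≠ j := by simpa using hi
    obtain ⟨x, hx⟩ := hB 0 j.succ ⟨(Fin.succ_ne_zero j).symm, Or.inl rfl⟩ i.succ
      (Fin.succ_ne_zero i) (fun h => hij (Fin.succ_injective _ h))
    simp only [Finset.mem_sdiff, Finset.mem_union, not_or] at hx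
    have := hsub hx.1
    simp only [Finset.singleton_biUnion] at this
    exact hx.2.2 this
  · rintro ⟨B, hB⟩
    have key : ∀ i j : Fin m, i ≠ j → (B i \ B j).Nonempty := by
      intro i j hij
      have := hB i {j} (by simp) (by simpa using hij)
      rw [Finset.singleton_biUnion] at this
      exact Finset.sdiff_nonempty.mpr this
    refine ⟨Fin.cons ∅ B, ?_⟩
    rintro a b ⟨hab, h0⟩ c hca hcb
    cases a using Fin.cases <;> cases b using Fin.cases <;> cases c using Fin.cases <;>
      simp_all
end

section
/- For every n ≥ 3, the star graph S_n satisfies t(S_n) = t(1, n−1) + 1. -/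
open Finset

theorem aux_cff_iff (t m : ℕ) (B : Fin m → Finset (Fin t)) :
    IsCFF 1 t m B ↔ ∀ i j, i ≠ j → ∃ x, x ∈ B i ∧ x ∉ B j := by
  constructor
  · intro h i j hij
    have := h i {j} (by simp) (by simpa using hij)
    rw [Finset.singleton_biUnion, Finset.not_subset] at this
    exact this
  · intro h i S hS hi
    obtain ⟨j, rfl⟩ := Finset.card_eq_one.mp hS
    rw [Finset.singleton_biUnion, Finset.not_subset]
    exact h i j (by simpa using hi)

theorem aux_up_s15 (t m : ℕ) (hm : 2 ≤ m) (B : Fin m → Finset (Fin t)) (h : IsCFF 1 t m B) :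
    ∃ C : Fin (m + 1) → Finset (Fin (t + 1)), IsGCFF (starGraph (m + 1)) C := by
  rw [aux_cff_iff] at h
  have hne : ∀ i, ∃ x, x ∈ B i := by
    intro i
    haveI : Nontrivial (Fin m) := Fin.nontrivial_iff_two_le.mpr hm
    obtain ⟨j, hj⟩ := exists_ne i
    obtain ⟨x, hx, _⟩ := h i j hj.symm
    exact ⟨x, hx⟩
  let C : Fin (m + 1) → Finset (Fin (t + 1)) :=
    Fin.cons {Fin.last t} (fun i => (B i).map Fin.castSuccEmb)
  have hC0 : ∀ x, x ∈ C 0 ↔ x = Fin.last t := by intro x; simp [C]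
  have hCl : ∀ i : Fin m, Fin.last t ∉ C i.succ := by
    intro i; simp [C, Fin.castSucc_ne_last]
  have hCs : ∀ (i : Fin m) (x : Fin t), x.castSucc ∈ C i.succ ↔ x ∈ B i := by
    intro i x; simp [C]
  have hC0' : ∀ x : Fin t, x.castSucc ∉ C 0 := by
    intro x; rw [hC0]; exact Fin.castSucc_ne_last x
  have key : ∀ i c : Fin m, c ≠ i → ∃ x, x ∈ C c.succ ∧ x ∉ C 0 ∧ x ∉ C i.succ := by
    intro i c hci
    obtain ⟨x, hx, hx'⟩ := h c i hci
    exact ⟨x.castSucc, (hCs _ _).2 hx, hC0' x, fun hh => hx' ((hCs _ _).1 hh)⟩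
  have sp1 : ∀ i : Fin m, (C 0 \ C i.succ).Nonempty := fun i =>
    ⟨Fin.last t, Finset.mem_sdiff.2 ⟨(hC0 _).2 rfl, hCl i⟩⟩
  have sp2 : ∀ i : Fin m, (C i.succ \ C 0).Nonempty := fun i => by
    obtain ⟨x, hx⟩ := hne i
    exact ⟨x.castSucc, Finset.mem_sdiff.2 ⟨(hCs _ _).2 hx, hC0' x⟩⟩
  refine ⟨C, ?_, ?_⟩
  · intro a b hab c hca hcb
    obtain ⟨hne, h0⟩ := hab
    induction a using Fin.cases with
    | zero =>
      induction b using Fin.cases with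
      | zero => exact absurd rfl hne
      | succ i =>
        obtain ⟨c, rfl⟩ := Fin.exists_succ_eq.2 hca
        obtain ⟨x, h1, h2, h3⟩ := key i c (fun e => hcb (by rw [e]))
        exact ⟨x, by simp [h1, h2, h3]⟩
    | succ i =>
      induction b using Fin.cases with
      | zero =>
        obtain ⟨c, rfl⟩ := Fin.exists_succ_eq.2 hcb
        obtain ⟨x, h1, h2, h3⟩ := key i c (fun e => hca (by rw [e]))
        exact ⟨x, by simp [h1, h2, h3]⟩
      | succ j => simp at h0
  · intro a b hab
    obtain ⟨hne, h0⟩ := hab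
    induction a using Fin.cases with
    | zero =>
      induction b using Fin.cases with
      | zero => exact absurd rfl hne
      | succ i => exact ⟨sp1 i, sp2 i⟩
    | succ i =>
      induction b using Fin.cases with
      | zero => exact ⟨sp2 i, sp1 i⟩
      | succ j => simp at h0

theorem aux_down (t m : ℕ) (hm : 2 ≤ m) (C : Fin (m + 1) → Finset (Fin t))
    (h : IsGCFF (starGraph (m + 1)) C) :
    ∃ s, t = s + 1 ∧ ∃ B : Fin m → Finset (Fin s), IsCFF 1 s m B := by
  obtain ⟨hE, hS⟩ := h
  have hadj : ∀ i : Fin m, (starGraph (m + 1)).Adj 0 i.succ := fun i =>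
    ⟨(Fin.succ_ne_zero i).symm, Or.inl rfl⟩
  obtain ⟨x, hx⟩ := (hS _ _ (hadj ⟨0, by omega⟩)).1
  have hx0 := (Finset.mem_sdiff.1 hx).1
  obtain _ | s := t
  · exact x.elim0
  refine ⟨s, rfl, fun i => Finset.univ.filter
    (fun y => x.succAbove y ∈ C i.succ ∧ x.succAbove y ∉ C 0), ?_⟩
  rw [aux_cff_iff]
  intro i j hij
  obtain ⟨y, hy⟩ := hE _ _ (hadj j) i.succ (Fin.succ_ne_zero i)
    (fun e => hij (Fin.succ_injective _ e))
  simp only [Finset.mem_sdiff, Finset.mem_union, not_or] at hy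
  obtain ⟨h1, h2, h3⟩ := hy
  obtain ⟨z, rfl⟩ := Fin.exists_succAbove_eq (x := y) (y := x)
    (fun e => h2 (by rw [e]; exact hx0))
  exact ⟨z, by simp [h1, h2], by simp [h3]⟩

theorem stmt_15 (n : ℕ) (hn : 3 ≤ n) :
    tG (starGraph n) = tCFF 1 (n - 1) + 1 := by
  obtain ⟨m, rfl⟩ : ∃ m, n = m + 1 := ⟨n - 1, by omega⟩
  have hm : 2 ≤ m := by omega
  rw [Nat.add_sub_cancel]
  have hne : {t | ∃ B : Fin m → Finset (Fin t), IsCFF 1 t m B}.Nonempty := by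
    refine ⟨m, fun i => {i}, ?_⟩
    rw [aux_cff_iff]
    intro i j hij
    exact ⟨i, by simp, by simpa using hij⟩
  obtain ⟨B, hB⟩ := Nat.sInf_mem hne
  have hup := aux_up_s15 _ m hm B hB
  apply le_antisymm
  · exact Nat.sInf_le hup
  · have hne2 : {t | ∃ C : Fin (m + 1) → Finset (Fin t),
        IsGCFF (starGraph (m + 1)) C}.Nonempty := ⟨_, hup⟩
    obtain ⟨C, hC⟩ := Nat.sInf_mem hne2
    obtain ⟨s, hs, hB'⟩ := aux_down _ m hm C hC
    have h1 : tCFF 1 m ≤ s := Nat.sInf_le hB'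
    have h2 : tG (starGraph (m + 1)) = s + 1 := hs
    omega
end

section
/- Let x ≥ 4 be an integer such that m = choose(x, ⌊x/2⌋) is even. Then the perfect matching graph E_m on m vertices satisfies t(E_m) = x + 1. -/
open Finset

/-- The perfect matching graph `E_m` on `Fin m` (for even `m`): its edges are the
pairwise disjoint pairs `{2i, 2i+1}` for `0 ≤ i < m/2`. -/
def matchingGraph (m : ℕ) : SimpleGraph (Fin m) where
  Adj a b := a ≠ b ∧ a.val / 2 = b.val / 2
  symm := ⟨fun _ _ h => ⟨h.1.symm, h.2.symm⟩⟩
  loopless := ⟨fun _ h => h.1 rfl⟩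

theorem upper_aux (x : ℕ) (hx : 4 ≤ x) :
    ∃ B : Fin (x.choose (x / 2)) → Finset (Fin (x + 1)),
      IsGCFF (matchingGraph (x.choose (x / 2))) B := by
  set m := x.choose (x / 2) with hmdef
  let W : Finset (Fin (x + 1)) := Finset.univ.filter (fun i => i.val < x - 1)
  let S := powersetCard ((x - 1) / 2) W
  have hW : W.card = x - 1 := by
    have := Fin.card_filter_val_lt (n := x + 1) (m := x - 1)
    simp only [W]
    rw [this]
    omega
  have hS : S.card = (x - 1).choose ((x - 1) / 2) := by
    simp only [S, card_powersetCard, hW]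
  have hmS : m ≤ 2 * S.card := by
    rw [hS, hmdef]
    obtain ⟨y, rfl⟩ : ∃ y, x = y + 1 := ⟨x - 1, by omega⟩
    obtain ⟨k, hk⟩ : ∃ k, (y + 1) / 2 = k + 1 := ⟨(y + 1) / 2 - 1, by omega⟩
    rw [hk, Nat.choose_succ_succ]
    have h1 := Nat.choose_le_middle k y
    have h2 := Nat.choose_le_middle (k + 1) y
    simp only [Nat.add_sub_cancel]
    simp only [Nat.succ_eq_add_one] at *
    omega
  let e := S.equivFin.symm
  let g : Fin m → Finset (Fin (x + 1)) := fun i =>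
    (e ⟨i.val / 2, by have := i.2; omega⟩ : S).1
  have hgS : ∀ i, g i ∈ S := fun i => (e ⟨i.val / 2, _⟩).2
  have hgW : ∀ i, g i ⊆ W := fun i => (mem_powersetCard.1 (hgS i)).1
  have hgc : ∀ i, (g i).card = (x - 1) / 2 := fun i => (mem_powersetCard.1 (hgS i)).2
  have hg1 : ∀ i j : Fin m, i.val / 2 = j.val / 2 → g i = g j := by
    intro i j h
    simp only [g, h]
  have hg2 : ∀ i j : Fin m, g i = g j → i.val / 2 = j.val / 2 := by
    intro i j h
    have := e.injective (Subtype.ext h)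
    simpa using this
  have hWv : ∀ i, ∀ y ∈ g i, y.val < x - 1 := by
    intro i y hy
    have := hgW i hy
    simpa [W] using this
  let p : Fin m → Fin (x + 1) := fun i =>
    if i.val % 2 = 0 then ⟨x - 1, by omega⟩ else ⟨x, by omega⟩
  have hp : ∀ i, x - 1 ≤ (p i).val := by
    intro i
    simp only [p]
    split_ifs <;> simp
  have hpp : ∀ i j, i.val % 2 ≠ j.val % 2 → p i ≠ p j := by
    intro i j h
    simp only [p]
    split_ifs <;> simp <;> omega
  have hpg : ∀ i j, p i ∉ g j := by
    intro i j h
    have := hWv _ _ h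
    have := hp i
    omega
  have sp : ∀ a b, (matchingGraph m).Adj a b →
      (insert (p a) (g a) \ insert (p b) (g b)).Nonempty := by
    intro a b h
    obtain ⟨h1, h2⟩ : a ≠ b ∧ a.val / 2 = b.val / 2 := h
    have h1 : a.val ≠ b.val := fun h => h1 (Fin.ext h)
    refine ⟨p a, ?_⟩
    have := hpp a b (by omega)
    simp [this, hpg]
  refine ⟨fun i => insert (p i) (g i), ?_, ?_⟩
  · intro a b h c hca hcb
    obtain ⟨h1, h2⟩ : a ≠ b ∧ a.val / 2 = b.val / 2 := h
    have h1 : a.val ≠ b.val := fun h => h1 (Fin.ext h)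
    have hca : c.val ≠ a.val := fun h => hca (Fin.ext h)
    have hcb : c.val ≠ b.val := fun h => hcb (Fin.ext h)
    have h3 : ¬ g c ⊆ g a := by
      intro h
      have := hg2 _ _ (eq_of_subset_of_card_le h (by rw [hgc, hgc]))
      omega
    obtain ⟨y, hy, hya⟩ := not_subset.1 h3
    have hyp : ∀ i, y ≠ p i := by
      intro i h
      exact hpg i c (h ▸ hy)
    refine ⟨y, ?_⟩
    have := hg1 a b h2
    simp [hy, hya, hyp, ← this]
  · intro a b h
    exact ⟨sp a b h, sp b a h.symm⟩

theorem lower_aux (x t : ℕ) (hx : 4 ≤ x) (ht : t ≤ x) (hm : Even (x.choose (x / 2)))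
    (B : Fin (x.choose (x / 2)) → Finset (Fin t))
    (hB : IsGCFF (matchingGraph (x.choose (x / 2))) B) : False := by
  obtain ⟨hE, hSp⟩ := hB
  have hbig : ∀ s : Finset (Finset (Fin t)), IsAntichain (· ⊆ ·) (s : Set (Finset (Fin t))) →
      s.card ≤ x.choose (x / 2) := by
    intro s hs
    have h1 := hs.sperner
    rw [Fintype.card_fin] at h1
    exact h1.trans ((Nat.choose_le_choose _ ht).trans (Nat.choose_le_middle _ _))
  have hxm : x < x.choose (x / 2) := by
    refine lt_of_lt_of_le ?_ (Nat.choose_le_middle 2 x)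
    rw [Nat.choose_two_right, Nat.lt_iff_add_one_le, Nat.le_div_iff_mul_le (by norm_num)]
    obtain ⟨y, rfl⟩ : ∃ y, x = y + 4 := ⟨x - 4, by omega⟩
    simp only [Nat.add_succ_sub_one]
    nlinarith
  generalize x.choose (x / 2) = m at *
  have hpart : ∀ a : Fin m, ∃ b, (matchingGraph m).Adj a b := by
    intro a
    obtain ⟨r, hr⟩ := hm
    have := a.2
    by_cases h : a.val % 2 = 0
    · refine ⟨⟨a.val + 1, by omega⟩, ?_, ?_⟩
      · intro h; have := congrArg Fin.val h; simp at this
      · simp only; omega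
    · refine ⟨⟨a.val - 1, by omega⟩, ?_, ?_⟩
      · intro h; have := congrArg Fin.val h; simp only at this; omega
      · simp only; omega
  have hanti : ∀ c a : Fin m, B c ⊆ B a → c = a := by
    intro c a hca
    by_contra hne
    obtain ⟨b, hb⟩ := hpart a
    by_cases hcb : c = b
    · subst hcb
      obtain ⟨y, hy⟩ := (hSp _ _ hb).2
      simp only [mem_sdiff] at hy
      exact hy.2 (hca hy.1)
    · obtain ⟨y, hy⟩ := hE _ _ hb c hne hcb
      simp only [mem_sdiff, mem_union, not_or] at hy
      exact hy.2.1 (hca hy.1)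
  have hinj : Function.Injective B := fun a b h => hanti a b h.subset
  let F := univ.image B
  have hF : F.card = m := by
    simp only [F, card_image_of_injective _ hinj, card_univ, Fintype.card_fin]
  have hFa : IsAntichain (· ⊆ ·) (F : Set (Finset (Fin t))) := by
    intro u hu v hv huv hsub
    simp only [F, coe_image, coe_univ, Set.image_univ, Set.mem_range] at hu hv
    obtain ⟨i, rfl⟩ := hu
    obtain ⟨j, rfl⟩ := hv
    exact huv (congrArg B (hanti i j hsub))
  have hne : (univ : Finset (Fin m)).Nonempty := ⟨⟨0, by omega⟩, mem_univ _⟩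
  obtain ⟨a, -, hmax⟩ := exists_max_image univ (fun i => (B i).card) hne
  obtain ⟨b, hab⟩ := hpart a
  have hsp := hSp _ _ hab
  have hcf : ∀ c, c ≠ a → c ≠ b → ¬ B c ⊆ B a ∪ B b := by
    intro c h1 h2 h
    obtain ⟨y, hy⟩ := hE _ _ hab c h1 h2
    simp only [mem_sdiff] at hy
    exact hy.2 (h hy.1)
  -- adding one set yields a contradiction
  have key : ∀ D, D ⊆ B a ∪ B b → D.card = (B a).card → D ≠ B a → ¬ B b ⊆ D → False := by
    intro D h1 h2 h3 h4
    have up : ∀ i, ¬ B i ⊆ D := by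
      intro i hi
      by_cases hia : i = a
      · subst hia
        exact h3 (eq_of_subset_of_card_le hi h2.le).symm
      by_cases hib : i = b
      · subst hib; exact h4 hi
      exact hcf i hia hib (hi.trans h1)
    have dn : ∀ i, ¬ D ⊆ B i := by
      intro i hi
      have := eq_of_subset_of_card_le hi (by rw [h2]; exact hmax i (mem_univ _))
      exact up i this.symm.subset
    have hDF : D ∉ F := by
      intro h
      simp only [F, mem_image, mem_univ, true_and] at h
      obtain ⟨i, hi⟩ := h
      exact up i hi.subset
    have := hbig (insert D F) (by
      rw [coe_insert]
      refine hFa.insert ?_ ?_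
      · intro v hv _ h
        simp only [F, coe_image, coe_univ, Set.image_univ, Set.mem_range] at hv
        obtain ⟨i, rfl⟩ := hv
        exact up i h
      · intro v hv _ h
        simp only [F, coe_image, coe_univ, Set.image_univ, Set.mem_range] at hv
        obtain ⟨i, rfl⟩ := hv
        exact dn i h)
    rw [card_insert_of_notMem hDF] at this
    omega
  obtain ⟨e, he⟩ := hsp.2
  rw [mem_sdiff] at he
  -- general D
  have hDcard : ∀ g ∈ B a, (insert e ((B a).erase g)).card = (B a).card := by
    intro g hg
    rw [card_insert_of_notMem (by simp [he.2]), card_erase_of_mem hg]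
    have := card_pos.2 ⟨g, hg⟩
    omega
  have hDsub : ∀ g, insert e ((B a).erase g) ⊆ B a ∪ B b := by
    intro g
    refine insert_subset (mem_union_right _ he.1) ?_
    exact (erase_subset _ _).trans subset_union_left
  have hDne : ∀ g, insert e ((B a).erase g) ≠ B a := by
    intro g h
    exact he.2 (h ▸ mem_insert_self _ _)
  obtain ⟨g0, hg0⟩ := hsp.1
  rw [mem_sdiff] at hg0
  by_cases hf : ∃ f ∈ B b, f ≠ e
  · obtain ⟨f, hfb, hfe⟩ := hf
    by_cases hfa : f ∈ B a
    · refine key _ (hDsub f) (hDcard f hfa) (hDne f) ?_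
      intro h
      have := h hfb
      simp [hfe] at this
    · refine key _ (hDsub g0) (hDcard g0 hg0.1) (hDne g0) ?_
      intro h
      have := h hfb
      simp [hfe, hfa] at this
  push Not at hf
  have hbe : B b = {e} := by
    ext y
    simp only [mem_singleton]
    exact ⟨hf y, fun h => h ▸ he.1⟩
  have heC : ∀ c, e ∈ B c → c = b := by
    intro c h
    exact (hanti b c (by rw [hbe]; simpa using h)).symm
  by_cases hg : ∃ g ∈ B a, g ≠ g0
  · obtain ⟨g, hga, hgg⟩ := hg
    let D : Fin t → Finset (Fin t) := fun g => insert e ((B a).erase g)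
    have heD : ∀ g, e ∈ D g := fun g => mem_insert_self _ _
    have up : ∀ g ∈ B a, ∀ i, i ≠ b → ¬ B i ⊆ D g := by
      intro g hga i hib hi
      by_cases hia : i = a
      · subst hia
        have := hi hga
        have hge : g ≠ e := fun h => he.2 (h ▸ hga)
        simp [D, hge] at this
      exact hcf i hia hib (hi.trans (hDsub g))
    have dn : ∀ g ∈ B a, ∀ i, i ≠ b → ¬ D g ⊆ B i := by
      intro g _ i hib hi
      exact hib (heC i (hi (heD g)))
    have hDD : ∀ g ∈ B a, ∀ g' ∈ B a, g ≠ g' → ¬ D g ⊆ D g' := by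
      intro g hg g' hg' hne h
      have h1 : g' ∈ D g := by simp [D, hg', hne.symm]
      have h2 := h h1
      have hge : g' ≠ e := fun h => he.2 (h ▸ hg')
      simp [D, hge] at h2
    have hmem : ∀ v, v ∈ ((F.erase (B b) : Finset _) : Set (Finset (Fin t))) →
        ∃ i, i ≠ b ∧ B i = v := by
      intro v hv
      simp only [F, coe_erase, coe_image, coe_univ, Set.image_univ, Set.mem_diff,
        Set.mem_range, Set.mem_singleton_iff] at hv
      obtain ⟨⟨i, rfl⟩, h2⟩ := hv
      exact ⟨i, fun h => h2 (h ▸ rfl), rfl⟩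
    have hA0 : IsAntichain (· ⊆ ·) ((F.erase (B b) : Finset _) : Set (Finset (Fin t))) :=
      hFa.subset (by exact_mod_cast erase_subset _ _)
    have hn1 : D g ∉ F.erase (B b) := by
      intro h
      obtain ⟨i, hi, h⟩ := hmem _ (mem_coe.2 h)
      exact up g hga i hi h.subset
    have hn2 : D g0 ∉ insert (D g) (F.erase (B b)) := by
      intro h
      rcases mem_insert.1 h with h | h
      · exact hDD _ hg0.1 _ hga hgg.symm h.subset
      obtain ⟨i, hi, h⟩ := hmem _ (mem_coe.2 h)
      exact up g0 hg0.1 i hi h.subset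
    have hA1 : IsAntichain (· ⊆ ·)
        ((insert (D g) (F.erase (B b)) : Finset _) : Set (Finset (Fin t))) := by
      rw [coe_insert]
      refine hA0.insert ?_ ?_
      · intro v hv _ h
        obtain ⟨i, hi, rfl⟩ := hmem _ hv
        exact up g hga i hi h
      · intro v hv _ h
        obtain ⟨i, hi, rfl⟩ := hmem _ hv
        exact dn g hga i hi h
    have := hbig (insert (D g0) (insert (D g) (F.erase (B b)))) (by
      rw [coe_insert]
      refine hA1.insert ?_ ?_
      · intro v hv _ h
        rcases mem_insert.1 (mem_coe.1 hv) with rfl | hv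
        · exact hDD _ hga _ hg0.1 hgg h
        obtain ⟨i, hi, rfl⟩ := hmem _ (mem_coe.2 hv)
        exact up g0 hg0.1 i hi h
      · intro v hv _ h
        rcases mem_insert.1 (mem_coe.1 hv) with rfl | hv
        · exact hDD _ hg0.1 _ hga hgg.symm h
        obtain ⟨i, hi, rfl⟩ := hmem _ (mem_coe.2 hv)
        exact dn g0 hg0.1 i hi h)
    rw [card_insert_of_notMem hn2, card_insert_of_notMem hn1,
      card_erase_of_mem (mem_image_of_mem _ (mem_univ _)), hF] at this
    omega
  · push Not at hg
    have hac : (B a).card ≤ 1 := card_le_one.2 (fun u hu v hv => (hg u hu).trans (hg v hv).symm)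
    have hall : F ⊆ powersetCard 1 univ := by
      intro v hv
      simp only [F, mem_image, mem_univ, true_and] at hv
      obtain ⟨i, rfl⟩ := hv
      rw [mem_powersetCard]
      refine ⟨subset_univ _, le_antisymm ((hmax i (mem_univ _)).trans hac) ?_⟩
      obtain ⟨j, hj⟩ := hpart i
      obtain ⟨y, hy⟩ := (hSp _ _ hj).1
      exact card_pos.2 ⟨y, (mem_sdiff.1 hy).1⟩
    have := card_le_card hall
    rw [hF, card_powersetCard, card_univ, Fintype.card_fin, Nat.choose_one_right] at this
    omega

theorem stmt_16 (x : ℕ) (hx : 4 ≤ x) (hm : Even (x.choose (x / 2))) :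
    tG (matchingGraph (x.choose (x / 2))) = x + 1 := by
  apply le_antisymm
  · exact Nat.sInf_le (upper_aux x hx)
  · refine le_csInf ⟨_, upper_aux x hx⟩ ?_
    rintro t ⟨B, hB⟩
    by_contra h
    exact lower_aux x t hx (by omega) hm B hB
end

section
/- For n ≥ 2, define n̄ = min{ choose(x, ⌊x/2⌋) : x ∈ ℕ, choose(x, ⌊x/2⌋) ≥ n }. If n ≤ ⌊ (n̄ + 1)‾ / 2 ⌋ (where (n̄ + 1)‾ denotes the same minimum operation applied to n̄ + 1), then t(1, 2n) = t(1, n) + 1; otherwise t(1, 2n) = t(1, n) + 2. -/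
open Finset

/-- `n̄`: the least central binomial coefficient `choose(x, ⌊x/2⌋)` that is `≥ n`. -/
noncomputable def nbar (n : ℕ) : ℕ :=
  sInf {m : ℕ | (∃ x : ℕ, m = x.choose (x / 2)) ∧ n ≤ m}

def cb (x : ℕ) : ℕ := x.choose (x / 2)

lemma cff_iff (t n : ℕ) : (∃ B : Fin n → Finset (Fin t), IsCFF 1 t n B) ↔ n ≤ cb t := by
  constructor
  · rintro ⟨B, hB⟩
    have h : ∀ i j, i ≠ j → ¬ B i ⊆ B j := by
      intro i j hij
      have := hB i {j} (by simp) (by simpa using hij)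
      simpa using this
    have inj : Function.Injective B := by
      intro i j hij
      by_contra hne
      exact h i j hne (hij ▸ Finset.Subset.refl _)
    have ha : IsAntichain (· ⊆ ·) (SetLike.coe (Finset.univ.image B)) := by
      intro a ha b hb hab hsub
      simp at ha hb
      obtain ⟨i, rfl⟩ := ha
      obtain ⟨j, rfl⟩ := hb
      exact h i j (fun e => hab (by rw [e])) hsub
    have := ha.sperner
    rw [Finset.card_image_of_injective _ inj] at this
    simpa [cb] using this
  · intro h
    have hc : (Finset.powersetCard (t / 2) (Finset.univ : Finset (Fin t))).card = cb t := by
      simp [cb]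
    let e := (Finset.powersetCard (t / 2) (Finset.univ : Finset (Fin t))).equivFinOfCardEq hc
    refine ⟨fun i => (e.symm (Fin.castLE h i)).1, ?_⟩
    intro i S hS hi hsub
    obtain ⟨j, rfl⟩ := Finset.card_eq_one.mp hS
    simp only [Finset.singleton_biUnion] at hsub
    have h1 := (Finset.mem_powersetCard.mp (e.symm (Fin.castLE h i)).2).2
    have h2 := (Finset.mem_powersetCard.mp (e.symm (Fin.castLE h j)).2).2
    have h3 := Finset.eq_of_subset_of_card_le hsub (by rw [h1, h2])
    have h4 := e.symm.injective (Subtype.ext h3)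
    have h5 := Fin.castLE_injective h h4
    simp [h5] at hi

lemma cb_succ_le (t : ℕ) : cb (t + 1) ≤ 2 * cb t := by
  unfold cb
  rcases Nat.eq_zero_or_pos ((t + 1) / 2) with h | h
  · rw [h]
    have := Nat.choose_pos (Nat.div_le_self t 2)
    simp
    omega
  · obtain ⟨k, hk⟩ := Nat.exists_eq_succ_of_ne_zero h.ne'
    rw [hk, Nat.choose_succ_succ]
    have h1 := Nat.choose_le_middle k t
    have h2 := Nat.choose_le_middle (k + 1) t
    simp only [Nat.succ_eq_add_one]
    omega

lemma cb_lt_succ (t : ℕ) (ht : 1 ≤ t) : cb t < cb (t + 1) := by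
  unfold cb
  obtain ⟨k, hk⟩ := Nat.exists_eq_succ_of_ne_zero (show (t + 1) / 2 ≠ 0 by omega)
  rw [hk, Nat.choose_succ_succ]
  have h1 : 0 < t.choose k := Nat.choose_pos (by omega)
  have h2 : 0 < t.choose (k + 1) := Nat.choose_pos (by omega)
  simp only [Nat.succ_eq_add_one] at *
  rcases (show t / 2 = k ∨ t / 2 = k + 1 by omega) with h | h <;> rw [h] <;> omega

lemma cb_mono : Monotone cb := by
  refine monotone_nat_of_le_succ fun t => ?_
  rcases Nat.eq_zero_or_pos t with rfl | h
  · simp [cb]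
  · exact (cb_lt_succ t h).le

lemma two_cb_le (t : ℕ) : 2 * cb t ≤ cb (t + 2) := by
  unfold cb
  rw [show (t + 2) / 2 = t / 2 + 1 by omega, Nat.choose_succ_succ, Nat.choose_succ_succ t (t / 2)]
  have : t.choose (t / 2) ≤ (t + 1).choose (t / 2) := Nat.choose_le_choose _ (by omega)
  simp only [Nat.succ_eq_add_one] at *
  omega

lemma tcff_eq (n T : ℕ) (h1 : n ≤ cb (T + 1)) (h2 : cb T < n) : tCFF 1 n = T + 1 := by
  unfold tCFF
  simp only [cff_iff]
  apply le_antisymm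
  · exact Nat.sInf_le h1
  · refine le_csInf ⟨_, h1⟩ fun b hb => ?_
    by_contra hlt
    have := cb_mono (show b ≤ T by omega)
    simp only [Set.mem_ofPred_eq] at hb
    omega

lemma nbar_eq (n T : ℕ) (h1 : n ≤ cb (T + 1)) (h2 : cb T < n) : nbar n = cb (T + 1) := by
  unfold nbar
  apply le_antisymm
  · exact Nat.sInf_le ⟨⟨_, rfl⟩, h1⟩
  · refine le_csInf ⟨_, ⟨_, rfl⟩, h1⟩ ?_
    rintro b ⟨⟨x, rfl⟩, hb⟩
    change n ≤ cb x at hb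
    change _ ≤ cb x
    apply cb_mono
    by_contra hlt
    have := cb_mono (show x ≤ T by omega)
    omega

lemma exists_T (n : ℕ) (hn : 2 ≤ n) : ∃ T, n ≤ cb (T + 1) ∧ cb T < n := by
  have hex : ∃ t, n ≤ cb t := by
    refine ⟨n, ?_⟩
    have := Nat.choose_le_middle 1 n
    simpa [cb] using this
  classical
  have h1 := Nat.find_spec hex
  have h0 : Nat.find hex ≠ 0 := by
    intro h
    rw [h] at h1
    simp [cb] at h1
    omega
  obtain ⟨T, hT⟩ := Nat.exists_eq_succ_of_ne_zero h0
  rw [hT] at h1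
  refine ⟨T, h1, ?_⟩
  have := Nat.find_min hex (m := T) (by omega)
  omega

theorem stmt_17 (n : ℕ) (hn : 2 ≤ n) :
    (n ≤ nbar (nbar n + 1) / 2 → tCFF 1 (2 * n) = tCFF 1 n + 1) ∧
    (¬ n ≤ nbar (nbar n + 1) / 2 → tCFF 1 (2 * n) = tCFF 1 n + 2) := by
  obtain ⟨T, h1, h2⟩ := exists_T n hn
  have e1 := tcff_eq n T h1 h2
  have e2 := nbar_eq n T h1 h2
  have hs := cb_lt_succ (T + 1) (by omega)
  have e3 : nbar (cb (T + 1) + 1) = cb (T + 1 + 1) := nbar_eq _ (T + 1) (by omega) (by omega)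
  have h3 := cb_succ_le T
  have h4 := two_cb_le (T + 1)
  rw [e2, e3, e1]
  constructor
  · intro h
    exact tcff_eq _ (T + 1) (by omega) (by omega)
  · intro h
    exact tcff_eq _ (T + 1 + 1) (show _ ≤ cb (T + 1 + 2) by omega) (by omega)
end

section
/- For every n ≥ 3, t(P_n) ≤ t(C_n). Moreover, for every integer k ≥ 1: if 2·3^{k−1} < n ≤ 3^k then t(C_n) ≤ 3k; if 3^k < n ≤ 4·3^{k−1} then t(C_n) ≤ 3k + 1; and if 4·3^{k−1} < n ≤ 2·3^k then t(C_n) ≤ 3k + 2. -/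
open Finset

/-- The path graph `P_n` on `Fin n`, with edges `{i, i+1}` for `0 ≤ i ≤ n-2`. -/
def pathGraph (n : ℕ) : SimpleGraph (Fin n) where
  Adj a b := a.val + 1 = b.val ∨ b.val + 1 = a.val
  symm := ⟨fun _ _ h => h.symm⟩
  loopless := ⟨fun a h => by cases h <;> omega⟩

/-- The cycle graph `C_n` on `Fin n` (for `n ≥ 3`), with edges `{i, (i+1) mod n}`. -/
def cycleGraph (n : ℕ) : SimpleGraph (Fin n) where
  Adj a b := a ≠ b ∧ ((a.val + 1) % n = b.val ∨ (b.val + 1) % n = a.val)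
  symm := ⟨fun _ _ h => ⟨h.1.symm, h.2.symm⟩⟩
  loopless := ⟨fun _ h => h.1 rfl⟩

/-- Path-type system. -/
def PSys (t N : ℕ) : Prop := ∃ f : ℕ → Finset ℕ,
  (∀ i, i < N → ∀ x ∈ f i, x < t) ∧
  (∀ i j, i < N → j < N → i ≠ j → ∃ x ∈ f i, x ∉ f j) ∧
  (∀ i j, i + 1 < N → j < N → j ≠ i → j ≠ i + 1 → ∃ x ∈ f j, x ∉ f i ∧ x ∉ f (i + 1))

/-- Cycle-type system. -/
def CSys (t N : ℕ) : Prop := ∃ f : ℕ → Finset ℕ,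
  (∀ i, i < N → ∀ x ∈ f i, x < t) ∧
  (∀ i j, i < N → j < N → i ≠ j → ∃ x ∈ f i, x ∉ f j) ∧
  (∀ i j, i < N → j < N → j ≠ i → j ≠ (i + 1) % N →
    ∃ x ∈ f j, x ∉ f i ∧ x ∉ f ((i + 1) % N))

theorem CSys.toP {t N : ℕ} (h : CSys t N) : PSys t N := by
  obtain ⟨f, h1, h2, h3⟩ := h
  refine ⟨f, h1, h2, fun i j hi hj hne hne' => ?_⟩
  have := h3 i j (by omega) hj hne
  rw [Nat.mod_eq_of_lt hi] at this
  exact this hne'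

theorem CSys.exists {t N : ℕ} (h : CSys t N) :
    ∃ B : Fin N → Finset (Fin t), IsGCFF (cycleGraph N) B := by
  obtain ⟨f, h1, h2, h3⟩ := h
  refine ⟨fun i => Finset.univ.filter (fun x : Fin t => x.val ∈ f i.val), ?_, ?_⟩
  · rintro a b ⟨hab, h | h⟩ c hca hcb
    · obtain ⟨x, hx, hx1, hx2⟩ := h3 a c a.2 c.2 (fun e => hca (Fin.ext e))
        (fun e => hcb (Fin.ext (e.trans h)))
      rw [h] at hx2
      exact ⟨⟨x, h1 c c.2 x hx⟩, by simp [hx, hx1, hx2]⟩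
    · obtain ⟨x, hx, hx1, hx2⟩ := h3 b c b.2 c.2 (fun e => hcb (Fin.ext e))
        (fun e => hca (Fin.ext (e.trans h)))
      rw [h] at hx2
      exact ⟨⟨x, h1 c c.2 x hx⟩, by simp [hx, hx1, hx2]⟩
  · rintro a b ⟨hab, -⟩
    have hab' : a.val ≠ b.val := fun e => hab (Fin.ext e)
    obtain ⟨x, hx, hx1⟩ := h2 a b a.2 b.2 hab'
    obtain ⟨y, hy, hy1⟩ := h2 b a b.2 a.2 hab'.symm
    exact ⟨⟨⟨x, h1 a a.2 x hx⟩, by simp [hx, hx1]⟩, ⟨⟨y, h1 b b.2 y hy⟩, by simp [hy, hy1]⟩⟩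

theorem CSys.le {t N : ℕ} (h : CSys t N) : tG (cycleGraph N) ≤ t :=
  Nat.sInf_le h.exists

theorem CSys.triv (N : ℕ) : CSys N N := by
  refine ⟨fun i => {i}, ?_, ?_, ?_⟩
  · intro i hi x hx
    simp at hx
    omega
  · intro i j _ _ h
    exact ⟨i, by simp, by simpa using h⟩
  · intro i j _ _ h h'
    exact ⟨j, by simp, by simpa using h, by simpa using h'⟩

/-- Column of the `p`-th vertex. -/
def colF (L j p : ℕ) : ℕ :=
  if p < L then p else if p - L < 2 * j then L - 1 - (p - L) / 2 else L - 1 + j - (p - L)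

/-- Layer of the `p`-th vertex. -/
def layF (L j p : ℕ) : ℕ :=
  if p < L then 0 else
    if p - L < 2 * j then (if (p - L) % 4 = 0 ∨ (p - L) % 4 = 3 then 1 else 2)
    else (if (2 * j) % 4 = 0 then 1 else 2)

theorem colF_lt {L j p m : ℕ} (hj : j ≤ L) (hm : m = 2 * L + j) (hL : 0 < L) (hp : p < m) :
    colF L j p < L := by
  unfold colF
  split_ifs <;> omega

theorem layF_lt (L j p : ℕ) : layF L j p < 3 := by
  unfold layF
  split_ifs <;> omega

theorem cl_inj {L j p q m : ℕ} (hj : j ≤ L) (hm : m = 2 * L + j) (hp : p < m) (hq : q < m)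
    (h1 : colF L j p = colF L j q) (h2 : layF L j p = layF L j q) : p = q := by
  unfold colF at h1
  unfold layF at h2
  split_ifs at h1 h2 <;> omega

theorem cl_adj {L j p q m : ℕ} (hj : j ≤ L) (hm : m = 2 * L + j) (h3 : 3 ≤ m) (hp : p < m)
    (hq : q = (p + 1) % m) :
    (colF L j p = colF L j q) ∨
    (layF L j p = layF L j q ∧ (colF L j p + 1 = colF L j q ∨ colF L j q + 1 = colF L j p)) := by
  have hq' : (p + 1 < m ∧ q = p + 1) ∨ (p + 1 = m ∧ q = 0) := by
    rcases Nat.lt_or_ge (p + 1) m with h | h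
    · left
      exact ⟨h, by rw [hq, Nat.mod_eq_of_lt h]⟩
    · right
      have : p + 1 = m := by omega
      exact ⟨this, by rw [hq, this, Nat.mod_self]⟩
  clear hq
  rcases hq' with ⟨h, rfl⟩ | ⟨h, rfl⟩
  · by_cases hA : p + 1 < L
    · right
      simp [colF, layF, hA, (by omega : p < L)]
    · by_cases hB : p < L
      · left
        unfold colF
        split_ifs <;> omega
      · unfold colF layF
        split_ifs <;> omega
  · left
    unfold colF
    split_ifs <;> omega

theorem PSys.step {t N m : ℕ} (h : PSys t N) (h3 : 3 ≤ m) (hm : m ≤ 3 * N) : CSys (t + 3) m := by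
  obtain ⟨f, h1, h2, h4⟩ := h
  obtain ⟨L, j, hj, hL, hLN, hmL⟩ : ∃ L j, j ≤ L ∧ 0 < L ∧ L ≤ N ∧ m = 2 * L + j :=
    ⟨(m + 2) / 3, m - 2 * ((m + 2) / 3), by omega, by omega, by omega, by omega⟩
  have hc : ∀ p, p < m → colF L j p < N := fun p hp =>
    lt_of_lt_of_le (colF_lt hj hmL hL hp) hLN
  have nl : ∀ p q, q < m → t + layF L j p ∉ f (colF L j q) := by
    intro p q hq hmem
    have := h1 _ (hc q hq) _ hmem
    omega
  have ne : ∀ p q x, p < m → x ∈ f (colF L j p) → x ≠ t + layF L j q := by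
    intro p q x hp hx
    have := h1 _ (hc p hp) _ hx
    omega
  refine ⟨fun p => insert (t + layF L j p) (f (colF L j p)), ?_, ?_, ?_⟩
  · intro p hp x hx
    rcases Finset.mem_insert.1 hx with rfl | hx
    · have := layF_lt L j p
      omega
    · have := h1 _ (hc p hp) _ hx
      omega
  · intro p q hp hq hpq
    by_cases e : colF L j p = colF L j q
    · have e2 : layF L j p ≠ layF L j q := fun e2 => hpq (cl_inj hj hmL hp hq e e2)
      exact ⟨_, Finset.mem_insert_self _ _, by simp [e2, nl p q hq]⟩
    · obtain ⟨x, hx, hx'⟩ := h2 _ _ (hc p hp) (hc q hq) e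
      exact ⟨x, Finset.mem_insert_of_mem hx, by simp [hx', ne p q x hp hx]⟩
  · intro p c hp hcm hcp hcq
    generalize hq : (p + 1) % m = q at *
    have hqm : q < m := by
      rw [← hq]
      exact Nat.mod_lt _ (by omega)
    by_cases hcl : layF L j c ≠ layF L j p ∧ layF L j c ≠ layF L j q
    · exact ⟨_, Finset.mem_insert_self _ _, by simp [hcl.1, nl c p hp],
        by simp [hcl.2, nl c q hqm]⟩
    · have key : ∃ x ∈ f (colF L j c), x ∉ f (colF L j p) ∧ x ∉ f (colF L j q) := by
        have i1 : colF L j c = colF L j p → layF L j c ≠ layF L j p :=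
          fun e e2 => hcp (cl_inj hj hmL hcm hp e e2)
        have i2 : colF L j c = colF L j q → layF L j c ≠ layF L j q :=
          fun e e2 => hcq (cl_inj hj hmL hcm hqm e e2)
        rcases cl_adj hj hmL h3 hp hq.symm with e | ⟨e, e' | e'⟩
        · have : colF L j c ≠ colF L j p := by
            intro e3
            exact hcl ⟨i1 e3, i2 (e3.trans e)⟩
          obtain ⟨x, hx, hx'⟩ := h2 _ _ (hc c hcm) (hc p hp) this
          exact ⟨x, hx, hx', e ▸ hx'⟩
        · have hh := h4 (colF L j p) (colF L j c) (e' ▸ hc q hqm) (hc c hcm)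
            (fun e3 => hcl ⟨i1 e3, e ▸ i1 e3⟩)
          rw [e'] at hh
          exact hh (fun e3 => hcl ⟨e ▸ i2 e3, i2 e3⟩)
        · have hh := h4 (colF L j q) (colF L j c) (e' ▸ hc p hp) (hc c hcm)
            (fun e3 => hcl ⟨e ▸ i2 e3, i2 e3⟩)
          rw [e'] at hh
          obtain ⟨x, hx, ha, hb⟩ := hh (fun e3 => hcl ⟨i1 e3, e ▸ i1 e3⟩)
          exact ⟨x, hx, hb, ha⟩
      obtain ⟨x, hx, ha, hb⟩ := key
      exact ⟨x, Finset.mem_insert_of_mem hx, by simp [ha, ne c p x hcm hx],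
        by simp [hb, ne c q x hcm hx]⟩

theorem PSys.pow {t N : ℕ} (h : PSys t N) (hN : 0 < N) (k : ℕ) :
    PSys (t + 3 * k) (N * 3 ^ k) := by
  induction k with
  | zero => simpa using h
  | succ k ih =>
    have hp : 0 < N * 3 ^ k := by positivity
    have := (ih.step (m := 3 * (N * 3 ^ k)) (by omega) le_rfl).toP
    convert this using 1 <;> ring

theorem PSys.one : PSys 0 1 :=
  ⟨fun _ => ∅, by simp, fun i j hi hj h => absurd h (by omega), fun i j hi => absurd hi (by omega)⟩

theorem stmt_19 (n : ℕ) (hn : 3 ≤ n) :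
    tG (pathGraph n) ≤ tG (cycleGraph n) ∧
      ∀ k : ℕ, 1 ≤ k →
        (2 * 3 ^ (k - 1) < n ∧ n ≤ 3 ^ k → tG (cycleGraph n) ≤ 3 * k) ∧
        (3 ^ k < n ∧ n ≤ 4 * 3 ^ (k - 1) → tG (cycleGraph n) ≤ 3 * k + 1) ∧
        (4 * 3 ^ (k - 1) < n ∧ n ≤ 2 * 3 ^ k → tG (cycleGraph n) ≤ 3 * k + 2) := by
  refine ⟨?_, ?_⟩
  · obtain ⟨B, hB1, hB2⟩ := Nat.sInf_mem
      (s := {t | ∃ B : Fin n → Finset (Fin t), IsGCFF (cycleGraph n) B})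
      ⟨n, (CSys.triv n).exists⟩
    have hadj : ∀ a b, (pathGraph n).Adj a b → (cycleGraph n).Adj a b := by
      intro a b h
      refine ⟨h.ne, ?_⟩
      rcases h with h | h
      · left
        rw [h, Nat.mod_eq_of_lt b.2]
      · right
        rw [h, Nat.mod_eq_of_lt a.2]
    exact Nat.sInf_le ⟨B, fun a b h => hB1 a b (hadj a b h), fun a b h => hB2 a b (hadj a b h)⟩
  · intro k hk
    obtain ⟨k, rfl⟩ : ∃ l, k = l + 1 := ⟨k - 1, by omega⟩
    simp only [Nat.add_sub_cancel]
    refine ⟨?_, ?_, ?_⟩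
    · rintro ⟨-, h⟩
      have := ((PSys.one.pow one_pos k).step hn (by rw [pow_succ] at h; omega)).le
      omega
    · rintro ⟨h0, h⟩
      cases k with
      | zero =>
        have : n = 4 := by
          simp at h h0
          omega
        subst this
        exact (CSys.triv 4).le
      | succ k =>
        have := (((CSys.triv 4).toP.pow (by norm_num) k).step hn
          (by rw [pow_succ] at h; omega)).le
        omega
    · rintro ⟨-, h⟩
      have := (((CSys.triv 2).toP.pow (by norm_num) k).step hn
          (by rw [pow_succ] at h; omega)).le
      omega
end
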